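/- arXiv:1402.6563 — 6 statements merged into one kernel-verified Lean document; each statement's English description precedes it below -/
import Mathlib

section
/- (Flux bound for the energy) For all constants C₁ > 0, C₂ > 0 there exists C₃ > 0 with the following property. Let M ≥ 0 and let u : Ω → ℝ² be a smooth divergence-free vector field with ∫₀¹ u₁(x₁,x₂) dx₂ = 0 for all x₁, whose vorticity ω = ∂₁u₂ − ∂₂u₁ satisfies ‖ω‖_{L∞(Ω)} ≤ M; suppose there is a smooth v₁ : Ω → ℝ with ∂₂v₁ = u₁ and ‖v₁‖_{L∞(Ω)} ≤ C₁M, and a smooth p : Ω → ℝ with ‖p‖_{L∞(Ω)} ≤ C₂M². Define e(x₁) = (1/2)∫₀¹ |u(x₁,x₂)|² dx₂ + M²/2, h(x₁) = ∫₀¹ (p + (1/2)|u|²) u₁ dx₂, d(x₁) = ∫₀¹ |∇u(x₁,x₂)|² dx₂, and f = ∂₁e − h. Then for every x₁ ∈ ℝ: |f(x₁)|² ≤ C₃(1+M)² e(x₁) d(x₁) and |∂₁e(x₁)|² ≤ 2 e(x₁) d(x₁). -/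
noncomputable section

open MeasureTheory Real

namespace NS

/-- First partial derivative of a function on `ℝ²`. -/
def pd1 (g : ℝ × ℝ → ℝ) (x : ℝ × ℝ) : ℝ := deriv (fun y => g (y, x.2)) x.1

/-- Second partial derivative of a function on `ℝ²`. -/
def pd2 (g : ℝ × ℝ → ℝ) (x : ℝ × ℝ) : ℝ := deriv (fun y => g (x.1, y)) x.2

/-- Euclidean square norm of a vector in `ℝ²`. -/
def vnorm2 (v : ℝ × ℝ) : ℝ := v.1 ^ 2 + v.2 ^ 2

/-- Vorticity `ω = ∂₁u₂ - ∂₂u₁`. -/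
def vort (u : ℝ × ℝ → ℝ × ℝ) (x : ℝ × ℝ) : ℝ :=
  pd1 (fun y => (u y).2) x - pd2 (fun y => (u y).1) x

/-- Squared norm of the full velocity gradient,
`|∇u|² = (∂₁u₁)² + (∂₂u₁)² + (∂₁u₂)² + (∂₂u₂)²`. -/
def gradsq (u : ℝ × ℝ → ℝ × ℝ) (x : ℝ × ℝ) : ℝ :=
  pd1 (fun y => (u y).1) x ^ 2 + pd2 (fun y => (u y).1) x ^ 2
    + pd1 (fun y => (u y).2) x ^ 2 + pd2 (fun y => (u y).2) x ^ 2

/-- Energy density `e(x₁) = (1/2)∫₀¹ |u|² dx₂ + M²/2`. -/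
def eDen (u : ℝ × ℝ → ℝ × ℝ) (M : ℝ) (y : ℝ) : ℝ :=
  (1/2) * (∫ x₂ in (0:ℝ)..1, vnorm2 (u (y, x₂))) + M ^ 2 / 2

/-- Inviscid energy flux `h(x₁) = ∫₀¹ (p + |u|²/2) u₁ dx₂`. -/
def hFlux (u : ℝ × ℝ → ℝ × ℝ) (pr : ℝ × ℝ → ℝ) (y : ℝ) : ℝ :=
  ∫ x₂ in (0:ℝ)..1, (pr (y, x₂) + (1/2) * vnorm2 (u (y, x₂))) * (u (y, x₂)).1

/-- Energy dissipation rate `d(x₁) = ∫₀¹ |∇u|² dx₂`. -/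
def dDiss (u : ℝ × ℝ → ℝ × ℝ) (y : ℝ) : ℝ :=
  ∫ x₂ in (0:ℝ)..1, gradsq u (y, x₂)

theorem hasDerivAt_pd1 {g : ℝ × ℝ → ℝ} (hg : ContDiff ℝ (⊤ : ℕ∞) g) (x t : ℝ) :
    HasDerivAt (fun y => g (y, t)) (pd1 g (x, t)) x := by
  have hg' : Differentiable ℝ g := hg.differentiable (by simp)
  have h : Differentiable ℝ (fun y => g (y, t)) := by fun_prop
  exact (h x).hasDerivAt

theorem hasDerivAt_pd2 {g : ℝ × ℝ → ℝ} (hg : ContDiff ℝ (⊤ : ℕ∞) g) (x t : ℝ) :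
    HasDerivAt (fun y => g (x, y)) (pd2 g (x, t)) t := by
  have hg' : Differentiable ℝ g := hg.differentiable (by simp)
  have h : Differentiable ℝ (fun y => g (x, y)) := by fun_prop
  exact (h t).hasDerivAt

theorem continuous_pd1 {g : ℝ × ℝ → ℝ} (hg : ContDiff ℝ (⊤ : ℕ∞) g) : Continuous (pd1 g) := by
  have hg' : Differentiable ℝ g := hg.differentiable (by simp)
  have h : pd1 g = fun x => fderiv ℝ g x (1, 0) := by
    ext ⟨x, t⟩
    exact ((hg' (x, t)).hasFDerivAt.comp_hasDerivAt x
      ((hasDerivAt_id x).prodMk (hasDerivAt_const x t))).deriv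
  rw [h]
  exact (hg.continuous_fderiv (by simp)).clm_apply continuous_const

theorem continuous_pd2 {g : ℝ × ℝ → ℝ} (hg : ContDiff ℝ (⊤ : ℕ∞) g) : Continuous (pd2 g) := by
  have hg' : Differentiable ℝ g := hg.differentiable (by simp)
  have h : pd2 g = fun x => fderiv ℝ g x (0, 1) := by
    ext ⟨x, t⟩
    exact ((hg' (x, t)).hasFDerivAt.comp_hasDerivAt t
      ((hasDerivAt_const t x).prodMk (hasDerivAt_id t))).deriv
  rw [h]
  exact (hg.continuous_fderiv (by simp)).clm_apply continuous_const

/-- Differentiation under the integral sign over the fibre `[0, 1]`. -/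
theorem hasDerivAt_integral_fibre {g : ℝ × ℝ → ℝ} (hg : ContDiff ℝ (⊤ : ℕ∞) g) (x : ℝ) :
    HasDerivAt (fun y => ∫ t in (0:ℝ)..1, g (y, t)) (∫ t in (0:ℝ)..1, pd1 g (x, t)) x := by
  have hc : Continuous g := hg.continuous
  have hc' : Continuous (pd1 g) := continuous_pd1 hg
  obtain ⟨C, hC⟩ := ((isCompact_closedBall x 1).prod
    (isCompact_Icc (a := (0:ℝ)) (b := 1))).exists_bound_of_continuousOn hc'.continuousOn
  refine (intervalIntegral.hasDerivAt_integral_of_dominated_loc_of_deriv_le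
    (F := fun y t => g (y, t)) (F' := fun y t => pd1 g (y, t)) (bound := fun _ => C)
    (Metric.closedBall_mem_nhds x one_pos) (.of_forall fun y => ?_) ?_ ?_ ?_ ?_ ?_).2
  · exact Continuous.aestronglyMeasurable (by fun_prop)
  · exact Continuous.intervalIntegrable (by fun_prop) _ _
  · exact Continuous.aestronglyMeasurable (by fun_prop)
  · refine .of_forall fun t ht y hy => hC (y, t) ⟨hy, ?_⟩
    rw [Set.uIoc_of_le zero_le_one] at ht
    exact Set.Ioc_subset_Icc_self ht
  · exact intervalIntegrable_const
  · exact .of_forall fun t _ y _ => hasDerivAt_pd1 hg y t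

/-- Cauchy-Schwarz inequality for continuous `ℝ²`-valued functions on `[0, 1]`. -/
theorem sq_integral_dot_le {a₁ a₂ b₁ b₂ : ℝ → ℝ} (ha₁ : Continuous a₁) (ha₂ : Continuous a₂)
    (hb₁ : Continuous b₁) (hb₂ : Continuous b₂) :
    (∫ t in (0:ℝ)..1, (a₁ t * b₁ t + a₂ t * b₂ t)) ^ 2 ≤
      (∫ t in (0:ℝ)..1, (a₁ t ^ 2 + a₂ t ^ 2)) * ∫ t in (0:ℝ)..1, (b₁ t ^ 2 + b₂ t ^ 2) := by
  have key : ∀ s : ℝ, 0 ≤ (∫ t in (0:ℝ)..1, (a₁ t ^ 2 + a₂ t ^ 2)) * (s * s) +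
      (2 * ∫ t in (0:ℝ)..1, (a₁ t * b₁ t + a₂ t * b₂ t)) * s +
      ∫ t in (0:ℝ)..1, (b₁ t ^ 2 + b₂ t ^ 2) := by
    intro s
    have h : 0 ≤ ∫ t in (0:ℝ)..1, ((s * a₁ t + b₁ t) ^ 2 + (s * a₂ t + b₂ t) ^ 2) :=
      intervalIntegral.integral_nonneg zero_le_one fun t _ => by positivity
    have e : ∀ t, (s * a₁ t + b₁ t) ^ 2 + (s * a₂ t + b₂ t) ^ 2 =
        (s * s) * (a₁ t ^ 2 + a₂ t ^ 2) + (2 * s) * (a₁ t * b₁ t + a₂ t * b₂ t) +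
          (b₁ t ^ 2 + b₂ t ^ 2) := fun t => by ring
    simp_rw [e] at h
    rw [intervalIntegral.integral_add (Continuous.intervalIntegrable (by fun_prop) _ _)
        (Continuous.intervalIntegrable (by fun_prop) _ _),
      intervalIntegral.integral_add (Continuous.intervalIntegrable (by fun_prop) _ _)
        (Continuous.intervalIntegrable (by fun_prop) _ _),
      intervalIntegral.integral_const_mul, intervalIntegral.integral_const_mul] at h
    linarith
  have := discrim_le_zero key
  rw [discrim] at this
  linarith

/-- Cauchy-Schwarz inequality for continuous functions on `[0, 1]`. -/
theorem sq_integral_mul_le {a b : ℝ → ℝ} (ha : Continuous a) (hb : Continuous b) :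
    (∫ t in (0:ℝ)..1, a t * b t) ^ 2 ≤
      (∫ t in (0:ℝ)..1, a t ^ 2) * ∫ t in (0:ℝ)..1, b t ^ 2 := by
  simpa using sq_integral_dot_le ha (continuous_const (y := (0:ℝ))) hb
    (continuous_const (y := (0:ℝ)))

/-- Poincaré inequality on `[0, 1]` for a function with a zero. -/
theorem integral_sq_le_integral_deriv_sq {g g' : ℝ → ℝ} (hg : ∀ t, HasDerivAt g (g' t) t)
    (hg' : Continuous g') {c : ℝ} (hc : c ∈ Set.Icc (0:ℝ) 1) (hgc : g c = 0) :
    ∫ t in (0:ℝ)..1, g t ^ 2 ≤ ∫ t in (0:ℝ)..1, g' t ^ 2 := by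
  have hgcont : Continuous g := continuous_iff_continuousAt.2 fun t => (hg t).continuousAt
  have hpt : ∀ t ∈ Set.Icc (0:ℝ) 1, g t ^ 2 ≤ ∫ t in (0:ℝ)..1, g' t ^ 2 := by
    intro t ht
    have h1 : g t = ∫ s in c..t, g' s := by
      rw [intervalIntegral.integral_eq_sub_of_hasDerivAt (fun s _ => hg s)
        (hg'.intervalIntegrable _ _), hgc, sub_zero]
    have h2 : |g t| ≤ ∫ s in (0:ℝ)..1, |g' s| := by
      rw [h1]
      refine (intervalIntegral.norm_integral_le_abs_integral_norm).trans
        ((intervalIntegral.abs_integral_mono_interval (c := 0) (d := 1) ?_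
          (.of_forall fun s => norm_nonneg _) (hg'.norm.intervalIntegrable _ _)).trans_eq ?_)
      · rw [Set.uIoc_of_le zero_le_one]
        exact Set.Ioc_subset_Ioc (le_min hc.1 ht.1) (max_le hc.2 ht.2)
      · exact abs_of_nonneg (intervalIntegral.integral_nonneg zero_le_one fun _ _ => norm_nonneg _)
    have h3 := sq_integral_mul_le hg'.abs (continuous_const (y := (1:ℝ)))
    simp only [mul_one, sq_abs, one_pow, intervalIntegral.integral_const, sub_zero,
      smul_eq_mul] at h3
    calc g t ^ 2 = |g t| ^ 2 := (sq_abs _).symm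
      _ ≤ (∫ s in (0:ℝ)..1, |g' s|) ^ 2 := by gcongr
      _ ≤ _ := h3
  calc ∫ t in (0:ℝ)..1, g t ^ 2 ≤ ∫ _ in (0:ℝ)..1, ∫ t in (0:ℝ)..1, g' t ^ 2 :=
        intervalIntegral.integral_mono_on zero_le_one
          (Continuous.intervalIntegrable (by fun_prop) _ _) intervalIntegrable_const hpt
    _ = _ := by simp

/-- Flux bound for the energy: with `f = ∂₁e - h`,
`|f|² ≤ C₃(1+M)² e d` and `|∂₁e|² ≤ 2 e d`. -/
theorem energy_flux_bound :
    ∀ C₁ > (0:ℝ), ∀ C₂ > (0:ℝ), ∃ C₃ > (0:ℝ),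
      ∀ M : ℝ, 0 ≤ M → ∀ (u : ℝ × ℝ → ℝ × ℝ) (v₁ pr : ℝ × ℝ → ℝ),
      ContDiff ℝ (⊤ : ℕ∞) u →
      (∀ x : ℝ × ℝ, u (x.1, x.2 + 1) = u x) →
      (∀ x : ℝ × ℝ, pd1 (fun y => (u y).1) x + pd2 (fun y => (u y).2) x = 0) →
      (∀ x₁ : ℝ, (∫ x₂ in (0:ℝ)..1, (u (x₁, x₂)).1) = 0) →
      (∀ x : ℝ × ℝ, |vort u x| ≤ M) →
      ContDiff ℝ (⊤ : ℕ∞) v₁ →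
      (∀ x : ℝ × ℝ, v₁ (x.1, x.2 + 1) = v₁ x) →
      (∀ x : ℝ × ℝ, pd2 v₁ x = (u x).1) →
      (∀ x : ℝ × ℝ, |v₁ x| ≤ C₁ * M) →
      ContDiff ℝ (⊤ : ℕ∞) pr →
      (∀ x : ℝ × ℝ, pr (x.1, x.2 + 1) = pr x) →
      (∀ x : ℝ × ℝ, |pr x| ≤ C₂ * M ^ 2) →
      ∀ x₁ : ℝ,
        (deriv (eDen u M) x₁ - hFlux u pr x₁) ^ 2
            ≤ C₃ * (1 + M) ^ 2 * eDen u M x₁ * dDiss u x₁ ∧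
        (deriv (eDen u M) x₁) ^ 2 ≤ 2 * eDen u M x₁ * dDiss u x₁ := by
  intro C₁ hC₁ C₂ hC₂
  refine ⟨6 * (1 + C₁ ^ 2 + C₂ ^ 2), by positivity, ?_⟩
  intro M hM u v p hu huper _ _ _ hv hvper hvu hvM hp _ hpM x
  obtain ⟨a, ha⟩ : ∃ a : ℝ × ℝ → ℝ, a = fun y => (u y).1 := ⟨_, rfl⟩
  obtain ⟨b, hb⟩ : ∃ b : ℝ × ℝ → ℝ, b = fun y => (u y).2 := ⟨_, rfl⟩
  have ha' : ∀ y, (u y).1 = a y := fun y => by rw [ha]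
  have hb' : ∀ y, (u y).2 = b y := fun y => by rw [hb]
  have has : ContDiff ℝ (⊤ : ℕ∞) a := ha ▸ hu.fst
  have hbs : ContDiff ℝ (⊤ : ℕ∞) b := hb ▸ hu.snd
  have hn : ∀ y, vnorm2 (u y) = a y ^ 2 + b y ^ 2 := fun y => by rw [vnorm2, ha', hb']
  have hgrad : ∀ y, gradsq u y = pd1 a y ^ 2 + pd2 a y ^ 2 + pd1 b y ^ 2 + pd2 b y ^ 2 :=
    fun y => by rw [gradsq, ha, hb]
  have hvone : v (x, 1) = v (x, 0) := by simpa using hvper (x, 0)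
  have haone : a (x, 1) = a (x, 0) := by simpa [ha] using congrArg Prod.fst (huper (x, 0))
  have hbone : b (x, 1) = b (x, 0) := by simpa [hb] using congrArg Prod.snd (huper (x, 0))
  have hva : ∀ t, HasDerivAt (fun t => v (x, t)) (a (x, t)) t := fun t => by
    rw [← ha', ← hvu]
    exact hasDerivAt_pd2 hv x t
  have ca := has.continuous
  have cb := hbs.continuous
  have cv := hv.continuous
  have cp := hp.continuous
  have ca1 := continuous_pd1 has
  have ca2 := continuous_pd2 has
  have cb1 := continuous_pd1 hbs
  have cb2 := continuous_pd2 hbs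
  obtain ⟨E, hE⟩ : ∃ E, E = ∫ t in (0:ℝ)..1, (a (x, t) ^ 2 + b (x, t) ^ 2) := ⟨_, rfl⟩
  have hE0 : 0 ≤ E := hE ▸ intervalIntegral.integral_nonneg zero_le_one fun _ _ => by positivity
  have heden : eDen u M x = 1 / 2 * E + M ^ 2 / 2 := by simp only [eDen, hn, hE]
  obtain ⟨D, hD⟩ : ∃ D, D = dDiss u x := ⟨_, rfl⟩
  have hD' : D = ∫ t in (0:ℝ)..1, (pd1 a (x, t) ^ 2 + pd2 a (x, t) ^ 2 + pd1 b (x, t) ^ 2 +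
      pd2 b (x, t) ^ 2) := by simp only [hD, dDiss, hgrad]
  have hD0 : 0 ≤ D := hD' ▸ intervalIntegral.integral_nonneg zero_le_one fun _ _ => by positivity
  have hD1 : ∫ t in (0:ℝ)..1, (pd1 a (x, t) ^ 2 + pd1 b (x, t) ^ 2) ≤ D := by
    rw [hD']
    refine intervalIntegral.integral_mono_on zero_le_one
      (Continuous.intervalIntegrable (by fun_prop) _ _)
      (Continuous.intervalIntegrable (by fun_prop) _ _) fun t _ => ?_
    linarith [sq_nonneg (pd2 a (x, t)), sq_nonneg (pd2 b (x, t))]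
  have hD2 : ∫ t in (0:ℝ)..1, (pd2 a (x, t) ^ 2 + pd2 b (x, t) ^ 2) ≤ D := by
    rw [hD']
    refine intervalIntegral.integral_mono_on zero_le_one
      (Continuous.intervalIntegrable (by fun_prop) _ _)
      (Continuous.intervalIntegrable (by fun_prop) _ _) fun t _ => ?_
    linarith [sq_nonneg (pd1 a (x, t)), sq_nonneg (pd1 b (x, t))]
  have hD3 : ∫ t in (0:ℝ)..1, pd2 a (x, t) ^ 2 ≤ D := by
    rw [hD']
    refine intervalIntegral.integral_mono_on zero_le_one
      (Continuous.intervalIntegrable (by fun_prop) _ _)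
      (Continuous.intervalIntegrable (by fun_prop) _ _) fun t _ => ?_
    linarith [sq_nonneg (pd1 a (x, t)), sq_nonneg (pd1 b (x, t)), sq_nonneg (pd2 b (x, t))]
  obtain ⟨P, hP⟩ : ∃ P, P = ∫ t in (0:ℝ)..1, (a (x, t) * pd1 a (x, t) + b (x, t) * pd1 b (x, t)) :=
    ⟨_, rfl⟩
  have hderiv : deriv (eDen u M) x = P := by
    have h := ((hasDerivAt_integral_fibre (g := fun y => a y ^ 2 + b y ^ 2)
      (by fun_prop) x).const_mul (1 / 2)).add_const (M ^ 2 / 2)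
    have he : eDen u M = fun y => 1 / 2 * (∫ t in (0:ℝ)..1, (a (y, t) ^ 2 + b (y, t) ^ 2)) +
        M ^ 2 / 2 := by
      ext y
      simp only [eDen, hn]
    rw [he, h.deriv, hP, ← intervalIntegral.integral_const_mul]
    congr 1
    ext t
    have := (((hasDerivAt_pd1 has x t).pow 2).add ((hasDerivAt_pd1 hbs x t).pow 2)).deriv
    change 1 / 2 * deriv _ _ = _
    erw [this]
    push_cast
    ring
  have hP2 : P ^ 2 ≤ E * D := by
    refine hP ▸ (sq_integral_dot_le (by fun_prop) (by fun_prop) (by fun_prop) (by fun_prop)).trans ?_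
    rw [← hE]
    gcongr
  obtain ⟨Q, hQ⟩ : ∃ Q, Q = ∫ t in (0:ℝ)..1, p (x, t) * a (x, t) := ⟨_, rfl⟩
  have hQ2 : Q ^ 2 ≤ (C₂ * M ^ 2) ^ 2 * D := by
    obtain ⟨c, hc, hc0⟩ := exists_hasDerivAt_eq_zero (f := fun t => v (x, t)) zero_lt_one
      (Continuous.continuousOn (by fun_prop)) hvone.symm fun t _ => hva t
    have hpo := (integral_sq_le_integral_deriv_sq (hasDerivAt_pd2 has x) (by fun_prop)
      (Set.Ioo_subset_Icc_self hc) hc0).trans hD3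
    have hp2 : ∫ t in (0:ℝ)..1, p (x, t) ^ 2 ≤ (C₂ * M ^ 2) ^ 2 := by
      calc _ ≤ ∫ _ in (0:ℝ)..1, (C₂ * M ^ 2) ^ 2 :=
            intervalIntegral.integral_mono_on zero_le_one
              (Continuous.intervalIntegrable (by fun_prop) _ _) intervalIntegrable_const
              fun t _ => sq_le_sq' (abs_le.1 (hpM _)).1 (abs_le.1 (hpM _)).2
        _ = _ := by simp
    refine hQ ▸ (sq_integral_mul_le (by fun_prop) (by fun_prop)).trans ?_
    exact mul_le_mul hp2 hpo (intervalIntegral.integral_nonneg zero_le_one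
      fun _ _ => sq_nonneg _) (sq_nonneg _)
  obtain ⟨R, hR⟩ : ∃ R, R = ∫ t in (0:ℝ)..1,
      (v (x, t) * a (x, t) * pd2 a (x, t) + v (x, t) * b (x, t) * pd2 b (x, t)) := ⟨_, rfl⟩
  have hR2 : R ^ 2 ≤ (C₁ * M) ^ 2 * E * D := by
    have hvE : ∫ t in (0:ℝ)..1, ((v (x, t) * a (x, t)) ^ 2 + (v (x, t) * b (x, t)) ^ 2) ≤
        (C₁ * M) ^ 2 * E := by
      rw [hE, ← intervalIntegral.integral_const_mul]
      refine intervalIntegral.integral_mono_on zero_le_one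
        (Continuous.intervalIntegrable (by fun_prop) _ _)
        (Continuous.intervalIntegrable (by fun_prop) _ _) fun t _ => ?_
      rw [mul_pow, mul_pow, ← mul_add]
      exact mul_le_mul_of_nonneg_right
        (sq_le_sq' (abs_le.1 (hvM _)).1 (abs_le.1 (hvM _)).2) (by positivity)
    refine hR ▸ (sq_integral_dot_le (by fun_prop) (by fun_prop) (by fun_prop) (by fun_prop)).trans ?_
    exact mul_le_mul hvE hD2 (intervalIntegral.integral_nonneg zero_le_one
      fun _ _ => by positivity) (by positivity)
  have hflux : hFlux u p x = Q - R := by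
    have hparts := intervalIntegral.integral_mul_deriv_eq_deriv_mul (a := 0) (b := 1)
      (u := fun t => a (x, t) ^ 2 + b (x, t) ^ 2) (v := fun t => v (x, t))
      (u' := fun t => 2 * (a (x, t) * pd2 a (x, t) + b (x, t) * pd2 b (x, t)))
      (v' := fun t => a (x, t))
      (fun t _ => by
        convert! ((hasDerivAt_pd2 has x t).pow 2).add ((hasDerivAt_pd2 hbs x t).pow 2) using 1
        push_cast
        ring)
      (fun t _ => hva t) (Continuous.intervalIntegrable (by fun_prop) _ _)
      (Continuous.intervalIntegrable (by fun_prop) _ _)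
    rw [haone, hbone, hvone, sub_self, zero_sub] at hparts
    have e : ∀ t, 2 * (a (x, t) * pd2 a (x, t) + b (x, t) * pd2 b (x, t)) * v (x, t) =
        2 * (v (x, t) * a (x, t) * pd2 a (x, t) + v (x, t) * b (x, t) * pd2 b (x, t)) :=
      fun t => by ring
    simp only [e] at hparts
    rw [intervalIntegral.integral_const_mul, ← hR] at hparts
    have e' : ∀ t, (p (x, t) + 1 / 2 * (a (x, t) ^ 2 + b (x, t) ^ 2)) * a (x, t) =
        p (x, t) * a (x, t) + 1 / 2 * ((a (x, t) ^ 2 + b (x, t) ^ 2) * a (x, t)) :=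
      fun t => by ring
    simp only [hFlux, hn, ha', e']
    rw [intervalIntegral.integral_add (Continuous.intervalIntegrable (by fun_prop) _ _)
      (Continuous.intervalIntegrable (by fun_prop) _ _), intervalIntegral.integral_const_mul,
      hparts, ← hQ]
    ring
  rw [hderiv, hflux, heden, ← hD]
  have hED : 0 ≤ E * D := mul_nonneg hE0 hD0
  have hMD : 0 ≤ M ^ 2 * D := by positivity
  refine ⟨?_, by linarith⟩
  have h3 : (P - (Q - R)) ^ 2 ≤ 3 * (P ^ 2 + Q ^ 2 + R ^ 2) := by
    linarith [sq_nonneg (P + Q), sq_nonneg (P - R), sq_nonneg (Q + R)]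
  have hM1 : 1 ≤ (1 + M) ^ 2 := by nlinarith
  have hM2 : M ^ 2 ≤ (1 + M) ^ 2 := by nlinarith
  have hF : E * D + M ^ 2 * D = 2 * ((1 / 2 * E + M ^ 2 / 2) * D) := by ring
  have bP : P ^ 2 ≤ (1 + M) ^ 2 * (E * D + M ^ 2 * D) := by nlinarith
  have bQ : Q ^ 2 ≤ C₂ ^ 2 * ((1 + M) ^ 2 * (E * D + M ^ 2 * D)) :=
    calc Q ^ 2 ≤ C₂ ^ 2 * (M ^ 2 * (M ^ 2 * D)) := hQ2.trans_eq (by ring)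
      _ ≤ _ := by gcongr; linarith
  have bR : R ^ 2 ≤ C₁ ^ 2 * ((1 + M) ^ 2 * (E * D + M ^ 2 * D)) :=
    calc R ^ 2 ≤ C₁ ^ 2 * (M ^ 2 * (E * D)) := hR2.trans_eq (by ring)
      _ ≤ _ := by gcongr; linarith
  calc _ ≤ 3 * (P ^ 2 + Q ^ 2 + R ^ 2) := h3
    _ ≤ 3 * ((1 + C₁ ^ 2 + C₂ ^ 2) * ((1 + M) ^ 2 * (E * D + M ^ 2 * D))) := by linarith
    _ = _ := by ring

end NS
end
end

section
/- (Localized energy estimate) Let β > 0, and let e, f, d : ℝ × [0,∞) → ℝ be smooth functions, bounded together with their first-order derivatives, such that e ≥ 0, d ≥ 0, ∂_t e = ∂₁ f − d, and f² ≤ β e d everywhere. Let e₀ = sup_{x₁∈ℝ} e(x₁, 0) and suppose e₀ < ∞. Fix T > 0 and set ρ = 1/√(βT) and χ_ρ(x₁) = exp(−ρ|x₁|). Then ∫_ℝ χ_ρ(x₁) e(x₁,T) dx₁ + (1/2) ∫₀^T ∫_ℝ χ_ρ(x₁) d(x₁,t) dx₁ dt ≤ 4 e₀ √(βT). -/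
noncomputable section

open MeasureTheory Real

namespace NS

/-- The weight `x ↦ exp (-ρ|x|)` has total mass `2 / ρ`. -/
theorem integral_exp_neg_mul_abs {ρ : ℝ} (hρ : 0 < ρ) :
    ∫ x : ℝ, Real.exp (-ρ * |x|) = 2 / ρ := by
  rw [integral_comp_abs (f := fun x => Real.exp (-ρ * x)),
    integral_exp_mul_Ioi (neg_lt_zero.2 hρ)]
  simp
  ring

theorem integrable_exp_neg_mul_abs {ρ : ℝ} (hρ : 0 < ρ) :
    Integrable fun x : ℝ => Real.exp (-ρ * |x|) := by
  refine Integrable.of_integral_ne_zero ?_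
  rw [integral_exp_neg_mul_abs hρ]
  positivity

/-- Bounded measurable functions are integrable against the weight `exp (-ρ|x|)`. -/
theorem integrable_exp_neg_mul_abs_mul {ρ B : ℝ} (hρ : 0 < ρ) {g : ℝ → ℝ} (hg : Measurable g)
    (hB : ∀ x, |g x| ≤ B) : Integrable fun x : ℝ => Real.exp (-ρ * |x|) * g x :=
  (integrable_exp_neg_mul_abs hρ).mul_bdd hg.aestronglyMeasurable (.of_forall hB)

/-- One-sided version of `integral_exp_neg_mul_abs_mul_deriv_le`, with a boundary term at `0`. -/
theorem integral_Ioi_exp_neg_mul_abs_mul_deriv_le {ρ B : ℝ} (hρ : 0 < ρ) {g : ℝ → ℝ}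
    (hg : Differentiable ℝ g) (hB : ∀ x, |g x| ≤ B) (hB' : ∀ x, |deriv g x| ≤ B) :
    ∫ x in Set.Ioi 0, Real.exp (-ρ * |x|) * deriv g x
      ≤ ρ * (∫ x in Set.Ioi 0, Real.exp (-ρ * |x|) * |g x|) - g 0 := by
  have hgm : Measurable g := hg.continuous.measurable
  have i1 := integrable_exp_neg_mul_abs_mul hρ (measurable_deriv g) hB'
  have i2 := integrable_exp_neg_mul_abs_mul hρ hgm hB
  have i3 := integrable_exp_neg_mul_abs_mul hρ hgm.abs (B := B) (by simpa using hB)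
  have hint : IntegrableOn (fun x => Real.exp (-ρ * x) * (-ρ) * g x
      + Real.exp (-ρ * x) * deriv g x) (Set.Ioi 0) := by
    refine ((i2.const_mul (-ρ)).add i1).integrableOn.congr_fun (fun x hx => ?_) measurableSet_Ioi
    simp only [Pi.add_apply, abs_of_pos (Set.mem_Ioi.1 hx)]
    ring
  have hlim : Filter.Tendsto (fun x => Real.exp (-ρ * x) * g x) Filter.atTop (nhds 0) := by
    refine squeeze_zero_norm (a := fun x => Real.exp (-ρ * x) * B) (fun x => ?_) ?_
    · rw [norm_mul, Real.norm_eq_abs, Real.norm_eq_abs, Real.abs_exp]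
      gcongr
      exact hB x
    · have : Filter.Tendsto (fun x => Real.exp (-ρ * x)) Filter.atTop (nhds 0) :=
        Real.tendsto_exp_atBot.comp
          (Filter.tendsto_id.const_mul_atTop_of_neg (neg_lt_zero.2 hρ))
      simpa using this.mul_const B
  have hFTC := integral_Ioi_of_hasDerivAt_of_tendsto' (a := 0)
    (f := fun x => Real.exp (-ρ * x) * g x)
    (fun x _ => by
      have h1 : HasDerivAt (fun x => Real.exp (-ρ * x)) (Real.exp (-ρ * x) * (-ρ)) x := by
        simpa using ((hasDerivAt_id x).const_mul (-ρ)).exp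
      exact h1.mul (hg x).hasDerivAt) hint hlim
  simp only [mul_zero, Real.exp_zero, one_mul, zero_sub] at hFTC
  rw [sub_eq_add_neg, ← hFTC, ← integral_const_mul,
    ← integral_add (i3.integrableOn.const_mul ρ) hint]
  refine setIntegral_mono_on i1.integrableOn ((i3.integrableOn.const_mul ρ).add hint)
    measurableSet_Ioi fun x hx => ?_
  rw [abs_of_pos (Set.mem_Ioi.1 hx)]
  have : 0 ≤ ρ * Real.exp (-ρ * x) * (|g x| - g x) :=
    mul_nonneg (by positivity) (sub_nonneg.2 (le_abs_self _))
  linarith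

/-- Integrating a derivative against `exp (-ρ|x|)` costs a factor `ρ`. -/
theorem integral_exp_neg_mul_abs_mul_deriv_le {ρ B : ℝ} (hρ : 0 < ρ) {g : ℝ → ℝ}
    (hg : Differentiable ℝ g) (hB : ∀ x, |g x| ≤ B) (hB' : ∀ x, |deriv g x| ≤ B) :
    ∫ x, Real.exp (-ρ * |x|) * deriv g x ≤ ρ * ∫ x, Real.exp (-ρ * |x|) * |g x| := by
  have hgm : Measurable g := hg.continuous.measurable
  have i1 := integrable_exp_neg_mul_abs_mul hρ (measurable_deriv g) hB'
  have i3 := integrable_exp_neg_mul_abs_mul hρ hgm.abs (B := B) (by simpa using hB)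
  have hpos := integral_Ioi_exp_neg_mul_abs_mul_deriv_le hρ hg hB hB'
  have hneg := integral_Ioi_exp_neg_mul_abs_mul_deriv_le hρ (g := fun x => -g (-x)) (B := B)
    (hg.comp differentiable_neg).neg (by simpa using fun x => hB (-x))
    (by simpa [deriv_comp_neg] using fun x => hB' (-x))
  have e1 := integral_comp_neg_Ioi 0 (fun x => Real.exp (-ρ * |x|) * deriv g x)
  have e2 := integral_comp_neg_Ioi 0 (fun x => Real.exp (-ρ * |x|) * |g x|)
  simp only [abs_neg, neg_zero] at e1 e2
  have hd : deriv (fun x => -g (-x)) = fun x => deriv g (-x) := by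
    ext x
    simp [deriv_comp_neg]
  simp only [hd, abs_neg, neg_zero, e1, e2] at hneg
  have s1 := intervalIntegral.integral_Iic_add_Ioi (b := 0) i1.integrableOn i1.integrableOn
  have s2 := intervalIntegral.integral_Iic_add_Ioi (b := 0) i3.integrableOn i3.integrableOn
  rw [← s1, ← s2]
  linarith

/-- The weighted integral of a bounded function on the half-plane `t ≥ 0`, continuous in each
variable, is continuous in `t`. -/
theorem continuousOn_integral_exp_neg_mul_abs_mul {ρ B : ℝ} (hρ : 0 < ρ) {u : ℝ → ℝ → ℝ}
    (hu : ContinuousOn (fun q : ℝ × ℝ => u q.1 q.2) {q : ℝ × ℝ | 0 ≤ q.2})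
    (hB : ∀ x t, 0 ≤ t → |u x t| ≤ B) :
    ContinuousOn (fun t => ∫ x, Real.exp (-ρ * |x|) * u x t) (Set.Ici 0) := by
  refine continuousOn_of_dominated (bound := fun x => Real.exp (-ρ * |x|) * B) (fun t ht => ?_)
    (fun t ht => .of_forall fun x => ?_) ((integrable_exp_neg_mul_abs hρ).mul_const B)
    (.of_forall fun x => ?_)
  · have : Continuous fun x => u x t :=
      hu.comp_continuous (f := fun x => (x, t)) (by fun_prop) fun _ => ht
    exact Continuous.aestronglyMeasurable (by fun_prop)
  · rw [norm_mul, Real.norm_eq_abs, Real.norm_eq_abs, Real.abs_exp]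
    gcongr
    exact hB x t ht
  · exact continuousOn_const.mul
      (hu.comp (f := fun t => (x, t)) (by fun_prop) fun t ht => ht)

/-- Young's inequality for the flux at the scale `ρ = 1 / √(βT)`. -/
theorem mul_abs_le_of_sq_le {β T a b c : ℝ} (hβ : 0 < β) (hT : 0 < T) (ha : 0 ≤ a) (hb : 0 ≤ b)
    (h : c ^ 2 ≤ β * a * b) :
    1 / Real.sqrt (β * T) * |c| ≤ 1 / 2 * b + 1 / (2 * T) * a := by
  refine abs_le_of_sq_le_sq' ?_ (by positivity) |>.2
  have hsq : (1 / Real.sqrt (β * T) * |c|) ^ 2 = c ^ 2 / (β * T) := by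
    rw [mul_pow, sq_abs, div_pow, Real.sq_sqrt (by positivity)]
    ring
  have h1 : c ^ 2 / (β * T) ≤ a * b / T := by
    rw [div_le_div_iff₀ (by positivity) hT]
    nlinarith [mul_le_mul_of_nonneg_right h hT.le]
  have h2 : (1 / 2 * b + 1 / (2 * T) * a) ^ 2 - a * b / T = (1 / 2 * b - 1 / (2 * T) * a) ^ 2 := by
    field_simp
    ring
  rw [hsq]
  nlinarith [sq_nonneg (1 / 2 * b - 1 / (2 * T) * a)]

/-- Localized energy estimate: if `e, f, d` are an energy density, flux and dissipation
with `∂ₜe = ∂₁f - d` and `f² ≤ β e d`, then with `ρ = 1/√(βT)` and `χ_ρ(x₁) = e^{-ρ|x₁|}`,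
`∫ χ_ρ e(·,T) + (1/2)∫₀ᵀ ∫ χ_ρ d ≤ 4 e₀ √(βT)`. -/
theorem localized_energy_estimate (β : ℝ) (hβ : 0 < β)
    (e f d : ℝ → ℝ → ℝ)
    (hes : ContDiffOn ℝ (⊤ : ℕ∞) (fun q : ℝ × ℝ => e q.1 q.2) {q : ℝ × ℝ | 0 ≤ q.2})
    (hfs : ContDiffOn ℝ (⊤ : ℕ∞) (fun q : ℝ × ℝ => f q.1 q.2) {q : ℝ × ℝ | 0 ≤ q.2})
    (hds : ContDiffOn ℝ (⊤ : ℕ∞) (fun q : ℝ × ℝ => d q.1 q.2) {q : ℝ × ℝ | 0 ≤ q.2})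
    (hbdd : ∃ B : ℝ, ∀ x₁ t : ℝ, 0 ≤ t →
      |e x₁ t| ≤ B ∧ |f x₁ t| ≤ B ∧ |d x₁ t| ≤ B ∧
      |deriv (fun y => e y t) x₁| ≤ B ∧ |deriv (fun s => e x₁ s) t| ≤ B ∧
      |deriv (fun y => f y t) x₁| ≤ B ∧ |deriv (fun s => f x₁ s) t| ≤ B ∧
      |deriv (fun y => d y t) x₁| ≤ B ∧ |deriv (fun s => d x₁ s) t| ≤ B)
    (hepos : ∀ x₁ t : ℝ, 0 ≤ t → 0 ≤ e x₁ t)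
    (hdpos : ∀ x₁ t : ℝ, 0 ≤ t → 0 ≤ d x₁ t)
    (heq : ∀ x₁ t : ℝ, 0 < t →
      deriv (fun s => e x₁ s) t = deriv (fun y => f y t) x₁ - d x₁ t)
    (hflux : ∀ x₁ t : ℝ, 0 ≤ t → f x₁ t ^ 2 ≤ β * e x₁ t * d x₁ t)
    (T : ℝ) (hT : 0 < T) :
    (∫ x₁ : ℝ, Real.exp (-(1 / Real.sqrt (β * T)) * |x₁|) * e x₁ T)
      + (1/2) * ∫ t in (0:ℝ)..T,
          ∫ x₁ : ℝ, Real.exp (-(1 / Real.sqrt (β * T)) * |x₁|) * d x₁ t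
      ≤ 4 * (⨆ x₁ : ℝ, e x₁ 0) * Real.sqrt (β * T) := by
  obtain ⟨B, hB⟩ := hbdd
  set ρ := 1 / Real.sqrt (β * T) with hρdef
  have hρ : 0 < ρ := by positivity
  have slice {u : ℝ → ℝ → ℝ}
      (hu : ContDiffOn ℝ (⊤ : ℕ∞) (fun q : ℝ × ℝ => u q.1 q.2) {q : ℝ × ℝ | 0 ≤ q.2})
      {t : ℝ} (ht : 0 ≤ t) : Continuous fun x => u x t :=
    hu.continuousOn.comp_continuous (f := fun x => (x, t)) (by fun_prop) fun _ => ht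
  have diffAt {u : ℝ → ℝ → ℝ}
      (hu : ContDiffOn ℝ (⊤ : ℕ∞) (fun q : ℝ × ℝ => u q.1 q.2) {q : ℝ × ℝ | 0 ≤ q.2})
      {t : ℝ} (ht : 0 < t) (x : ℝ) : DifferentiableAt ℝ (fun q : ℝ × ℝ => u q.1 q.2) (x, t) := by
    refine (hu.contDiffAt ?_).differentiableAt (by simp)
    filter_upwards [(isOpen_lt continuous_const continuous_snd).mem_nhds
      (show (x, t) ∈ {q : ℝ × ℝ | 0 < q.2} from ht)] with q hq using le_of_lt hq
  have int_e {t : ℝ} (ht : 0 ≤ t) : Integrable fun x => Real.exp (-ρ * |x|) * e x t :=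
    integrable_exp_neg_mul_abs_mul hρ (slice hes ht).measurable fun x => (hB x t ht).1
  have int_d {t : ℝ} (ht : 0 ≤ t) : Integrable fun x => Real.exp (-ρ * |x|) * d x t :=
    integrable_exp_neg_mul_abs_mul hρ (slice hds ht).measurable fun x => (hB x t ht).2.2.1
  have int_f {t : ℝ} (ht : 0 ≤ t) : Integrable fun x => Real.exp (-ρ * |x|) * |f x t| :=
    integrable_exp_neg_mul_abs_mul hρ (slice hfs ht).abs.measurable
      fun x => (abs_abs (f x t)).trans_le (hB x t ht).2.1
  have int_f' {t : ℝ} (ht : 0 ≤ t) :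
      Integrable fun x => Real.exp (-ρ * |x|) * deriv (fun y => f y t) x :=
    integrable_exp_neg_mul_abs_mul hρ (measurable_deriv _) fun x => (hB x t ht).2.2.2.2.2.1
  set E : ℝ → ℝ := fun t => ∫ x, Real.exp (-ρ * |x|) * e x t with hE
  set D : ℝ → ℝ := fun t => ∫ x, Real.exp (-ρ * |x|) * d x t with hD
  have hEcont : ContinuousOn E (Set.Ici 0) :=
    continuousOn_integral_exp_neg_mul_abs_mul hρ hes.continuousOn fun x t ht => (hB x t ht).1
  have hDcont : ContinuousOn D (Set.Ici 0) :=
    continuousOn_integral_exp_neg_mul_abs_mul hρ hds.continuousOn fun x t ht => (hB x t ht).2.2.1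
  have hDnn {t : ℝ} (ht : 0 ≤ t) : 0 ≤ D t :=
    integral_nonneg fun x => mul_nonneg (Real.exp_pos _).le (hdpos x t ht)
  have hEderiv {t : ℝ} (ht : 0 < t) : HasDerivAt E
      (∫ x, Real.exp (-ρ * |x|) * (deriv (fun y => f y t) x - d x t)) t := by
    refine (hasDerivAt_integral_of_dominated_loc_of_deriv_le (s := Set.Ioi 0)
      (F := fun t x => Real.exp (-ρ * |x|) * e x t)
      (F' := fun t x => Real.exp (-ρ * |x|) * (deriv (fun y => f y t) x - d x t))
      (bound := fun x => Real.exp (-ρ * |x|) * B) (Ioi_mem_nhds ht) ?_ (int_e ht.le) ?_ ?_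
      ((integrable_exp_neg_mul_abs hρ).mul_const B) ?_).2
    · filter_upwards [Ioi_mem_nhds ht] with s hs using (int_e (le_of_lt hs)).aestronglyMeasurable
    · simp only [mul_sub]
      exact ((int_f' ht.le).sub (int_d ht.le)).aestronglyMeasurable
    · refine .of_forall fun x s hs => ?_
      rw [norm_mul, Real.norm_eq_abs, Real.norm_eq_abs, Real.abs_exp, ← heq x s hs]
      gcongr
      exact (hB x s (le_of_lt hs)).2.2.2.2.1
    · refine .of_forall fun x s hs => ?_
      rw [← heq x s hs]
      have : DifferentiableAt ℝ (fun s => e x s) s :=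
        (diffAt hes hs x).comp s (f := fun s => (x, s)) (by fun_prop)
      exact this.hasDerivAt.const_mul _
  have hEle {t : ℝ} (ht : 0 < t) :
      ∫ x, Real.exp (-ρ * |x|) * (deriv (fun y => f y t) x - d x t)
        ≤ 1 / (2 * T) * E t - 1 / 2 * D t := by
    have hfd : Differentiable ℝ fun y => f y t := fun x =>
      (diffAt hfs ht x).comp x (f := fun y => (y, t)) (by fun_prop)
    have hparts := integral_exp_neg_mul_abs_mul_deriv_le hρ hfd
      (fun x => (hB x t ht.le).2.1) (fun x => (hB x t ht.le).2.2.2.2.2.1)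
    have hyoung : ρ * ∫ x, Real.exp (-ρ * |x|) * |f x t| ≤ 1 / 2 * D t + 1 / (2 * T) * E t := by
      rw [hE, hD, ← integral_const_mul, ← integral_const_mul, ← integral_const_mul,
        ← integral_add ((int_d ht.le).const_mul _) ((int_e ht.le).const_mul _)]
      refine integral_mono ((int_f ht.le).const_mul ρ)
        (((int_d ht.le).const_mul _).add ((int_e ht.le).const_mul _)) fun x => ?_
      have := mul_le_mul_of_nonneg_left (mul_abs_le_of_sq_le hβ hT (hepos x t ht.le)
        (hdpos x t ht.le) (hflux x t ht.le)) (Real.exp_pos (-ρ * |x|)).le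
      simp only [← hρdef] at this
      dsimp only
      linarith
    simp only [mul_sub]
    rw [integral_sub (int_f' ht.le) (int_d ht.le)]
    change _ - D t ≤ _
    linarith
  have hgron := intervalIntegral.sub_le_integral_of_hasDeriv_right_of_le hT.le
    (g := fun t => Real.exp (-(1 / (2 * T)) * t) * E t)
    (g' := fun t => Real.exp (-(1 / (2 * T)) * t) * (-(1 / (2 * T))) * E t
      + Real.exp (-(1 / (2 * T)) * t)
        * ∫ x, Real.exp (-ρ * |x|) * (deriv (fun y => f y t) x - d x t))
    (φ := fun t => -(1 / 2 * Real.exp (-(1 / 2))) * D t)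
    (ContinuousOn.mul (by fun_prop) (hEcont.mono Set.Icc_subset_Ici_self))
    (fun t ht => by
      have h1 : HasDerivAt (fun t => Real.exp (-(1 / (2 * T)) * t))
          (Real.exp (-(1 / (2 * T)) * t) * (-(1 / (2 * T)))) t := by
        simpa using ((hasDerivAt_id t).const_mul (-(1 / (2 * T)))).exp
      exact (h1.mul (hEderiv ht.1)).hasDerivWithinAt)
    ((continuousOn_const.mul (hDcont.mono Set.Icc_subset_Ici_self)).integrableOn_Icc)
    (fun t ht => by
      have h1 := mul_le_mul_of_nonneg_left (hEle ht.1) (Real.exp_pos (-(1 / (2 * T)) * t)).le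
      have h2 : Real.exp (-(1 / 2)) ≤ Real.exp (-(1 / (2 * T)) * t) := by
        rw [Real.exp_le_exp, neg_mul, neg_le_neg_iff, one_div_mul_eq_div,
          div_le_div_iff₀ (by positivity) two_pos]
        linarith [ht.2]
      have h3 := mul_le_mul_of_nonneg_right h2 (hDnn ht.1.le)
      linarith)
  have hEzero : E 0 ≤ 2 * (⨆ x, e x 0) * Real.sqrt (β * T) := by
    have hbdd : BddAbove (Set.range fun x => e x 0) :=
      ⟨B, by rintro _ ⟨x, rfl⟩; exact (le_abs_self _).trans (hB x 0 le_rfl).1⟩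
    calc E 0 ≤ ∫ x, Real.exp (-ρ * |x|) * ⨆ x, e x 0 :=
          integral_mono (int_e le_rfl) ((integrable_exp_neg_mul_abs hρ).mul_const _) fun x =>
            mul_le_mul_of_nonneg_left (le_ciSup hbdd x) (Real.exp_pos _).le
      _ = 2 * (⨆ x, e x 0) * Real.sqrt (β * T) := by
          rw [integral_mul_const, integral_exp_neg_mul_abs hρ, hρdef]
          field_simp
  have hexp : 1 / 2 ≤ Real.exp (-(1 / 2)) := by
    linarith [Real.add_one_le_exp (-(1 / 2) : ℝ)]
  have hTexp : -(1 / (2 * T)) * T = -(1 / 2) := by field_simp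
  simp only [hTexp, mul_zero, Real.exp_zero, one_mul, intervalIntegral.integral_const_mul] at hgron
  have hnn : 0 ≤ E T + 1 / 2 * ∫ t in (0:ℝ)..T, D t :=
    add_nonneg (integral_nonneg fun x => mul_nonneg (Real.exp_pos _).le (hepos x T hT.le))
      (mul_nonneg (by norm_num) (intervalIntegral.integral_nonneg hT.le fun t ht => hDnn ht.1))
  have := mul_le_mul_of_nonneg_right hexp hnn
  linarith

end NS
end
end

section
/- (Exponential decay of the local energy in the laminar regime) Let κ ∈ (0,1), C₈ > 0, E₀ ≥ 0, and ε ∈ (0,1), and set γ = 8π²(1−ε)(1−κ) and η = ε(1−κ)/(C₈κ²). Let ê, f̂, d̂, ĝ : ℝ × [0,∞) → ℝ be smooth functions, bounded together with their first-order derivatives, with ê ≥ 0, d̂ ≥ 0, satisfying ∂_t ê = ∂₁ f̂ − d̂ − ĝ, ê ≤ d̂/(8π²), f̂² ≤ C₈ κ² d̂, |ĝ| ≤ κ d̂ everywhere, and ê(x₁,0) ≤ E₀ for all x₁ ∈ ℝ. Then for every t ≥ 0, sup_{a∈ℝ} ∫_{a−1}^{a+1} ê(x₁,t) dx₁ ≤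 2E₀ e^{−γt} + 2 (ηγ)^{−1/2} √(E₀) e^{−γt/2}. -/
noncomputable section

open MeasureTheory Real

namespace NS

section Calculus

variable {u : ℝ → ℝ → ℝ}

lemma hasDerivAt_snd_of_contDiffOn
    (hu : ContDiffOn ℝ (⊤ : ℕ∞) (fun q : ℝ × ℝ => u q.1 q.2) {q : ℝ × ℝ | 0 ≤ q.2})
    (x : ℝ) {t : ℝ} (ht : 0 < t) :
    HasDerivAt (fun s => u x s) (fderiv ℝ (fun q : ℝ × ℝ => u q.1 q.2) (x, t) (0, 1)) t := by
  have hnhds : {q : ℝ × ℝ | 0 ≤ q.2} ∈ nhds (x, t) :=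
    continuous_snd.continuousAt.preimage_mem_nhds (Ici_mem_nhds ht)
  have hd := ((hu.contDiffAt hnhds).differentiableAt (by simp)).hasFDerivAt
  have hc : HasDerivAt (fun s : ℝ => (x, s)) ((0 : ℝ), (1 : ℝ)) t :=
    (hasDerivAt_const t x).prodMk (hasDerivAt_id t)
  exact hd.comp_hasDerivAt t hc

lemma hasDerivAt_fst_of_contDiffOn
    (hu : ContDiffOn ℝ (⊤ : ℕ∞) (fun q : ℝ × ℝ => u q.1 q.2) {q : ℝ × ℝ | 0 ≤ q.2})
    (x : ℝ) {t : ℝ} (ht : 0 < t) :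
    HasDerivAt (fun y => u y t) (fderiv ℝ (fun q : ℝ × ℝ => u q.1 q.2) (x, t) (1, 0)) x := by
  have hnhds : {q : ℝ × ℝ | 0 ≤ q.2} ∈ nhds (x, t) :=
    continuous_snd.continuousAt.preimage_mem_nhds (Ici_mem_nhds ht)
  have hd := ((hu.contDiffAt hnhds).differentiableAt (by simp)).hasFDerivAt
  have hc : HasDerivAt (fun y : ℝ => (y, t)) ((1 : ℝ), (0 : ℝ)) x :=
    (hasDerivAt_id x).prodMk (hasDerivAt_const x t)
  exact hd.comp_hasDerivAt x hc

lemma continuous_fderiv_slice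
    (hu : ContDiffOn ℝ (⊤ : ℕ∞) (fun q : ℝ × ℝ => u q.1 q.2) {q : ℝ × ℝ | 0 ≤ q.2})
    {t : ℝ} (ht : 0 < t) (v : ℝ × ℝ) :
    Continuous fun x => fderiv ℝ (fun q : ℝ × ℝ => u q.1 q.2) (x, t) v := by
  have hopen : IsOpen {q : ℝ × ℝ | 0 < q.2} := isOpen_lt continuous_const continuous_snd
  have hsub : {q : ℝ × ℝ | 0 < q.2} ⊆ {q : ℝ × ℝ | 0 ≤ q.2} := fun q (h : 0 < q.2) => h.le
  have hc := (hu.mono hsub).continuousOn_fderiv_of_isOpen hopen (by simp)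
  have hs : Continuous fun x : ℝ => fderiv ℝ (fun q : ℝ × ℝ => u q.1 q.2) (x, t) :=
    hc.comp_continuous (by fun_prop) (fun _ => ht)
  exact hs.clm_apply continuous_const

lemma continuous_deriv_snd_slice
    (hu : ContDiffOn ℝ (⊤ : ℕ∞) (fun q : ℝ × ℝ => u q.1 q.2) {q : ℝ × ℝ | 0 ≤ q.2})
    {t : ℝ} (ht : 0 < t) : Continuous fun x => deriv (fun s => u x s) t := by
  simpa only [(hasDerivAt_snd_of_contDiffOn hu _ ht).deriv] using
    continuous_fderiv_slice hu ht (0, 1)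

lemma continuous_deriv_fst_slice
    (hu : ContDiffOn ℝ (⊤ : ℕ∞) (fun q : ℝ × ℝ => u q.1 q.2) {q : ℝ × ℝ | 0 ≤ q.2})
    {t : ℝ} (ht : 0 < t) : Continuous fun x => deriv (fun y => u y t) x := by
  simpa only [(hasDerivAt_fst_of_contDiffOn hu _ ht).deriv] using
    continuous_fderiv_slice hu ht (1, 0)

lemma continuous_slice
    (hu : ContDiffOn ℝ (⊤ : ℕ∞) (fun q : ℝ × ℝ => u q.1 q.2) {q : ℝ × ℝ | 0 ≤ q.2})
    {t : ℝ} (ht : 0 ≤ t) : Continuous fun x => u x t :=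
  hu.continuousOn.comp_continuous (f := fun x : ℝ => (x, t)) (by fun_prop) (fun _ => ht)

lemma hasDerivAt_integral_weight_mul
    (hu : ContDiffOn ℝ (⊤ : ℕ∞) (fun q : ℝ × ℝ => u q.1 q.2) {q : ℝ × ℝ | 0 ≤ q.2})
    {B : ℝ} (hB : ∀ x t : ℝ, 0 ≤ t → |deriv (fun s => u x s) t| ≤ B)
    {w : ℝ → ℝ} (hw : Continuous w) (p q : ℝ) {t : ℝ} (ht : 0 < t) :
    HasDerivAt (fun s => ∫ x in p..q, w x * u x s)
      (∫ x in p..q, w x * deriv (fun s => u x s) t) t := by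
  have hnhds : Set.Ioi (0 : ℝ) ∈ nhds t := Ioi_mem_nhds ht
  refine (intervalIntegral.hasDerivAt_integral_of_dominated_loc_of_deriv_le
    (F := fun s x => w x * u x s) (F' := fun s x => w x * deriv (fun r => u x r) s)
    (bound := fun x => |w x| * B) hnhds ?_ ?_ ?_ ?_ ?_ ?_).2
  · filter_upwards [hnhds] with s hs
    exact (hw.mul (continuous_slice hu (le_of_lt hs))).aestronglyMeasurable
  · exact (hw.mul (continuous_slice hu ht.le)).intervalIntegrable _ _
  · exact (hw.mul (continuous_deriv_snd_slice hu ht)).aestronglyMeasurable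
  · refine Filter.Eventually.of_forall fun x _ s hs => ?_
    rw [Real.norm_eq_abs, abs_mul]
    exact mul_le_mul_of_nonneg_left (hB x s (le_of_lt hs)) (abs_nonneg _)
  · exact (hw.abs.mul continuous_const).intervalIntegrable _ _
  · refine Filter.Eventually.of_forall fun x _ s hs => ?_
    exact (hasDerivAt_snd_of_contDiffOn hu x hs).differentiableAt.hasDerivAt.const_mul (w x)

lemma continuousOn_integral_weight_mul
    (hu : ContDiffOn ℝ (⊤ : ℕ∞) (fun q : ℝ × ℝ => u q.1 q.2) {q : ℝ × ℝ | 0 ≤ q.2})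
    {B : ℝ} (hB : ∀ x t : ℝ, 0 ≤ t → |u x t| ≤ B)
    {w : ℝ → ℝ} (hw : Continuous w) (p q : ℝ) :
    ContinuousOn (fun s => ∫ x in p..q, w x * u x s) (Set.Ici 0) := by
  intro t ht
  refine intervalIntegral.continuousWithinAt_of_dominated_interval
    (bound := fun x => |w x| * B) ?_ ?_ ?_ ?_
  · filter_upwards [self_mem_nhdsWithin] with s hs
    exact (hw.mul (continuous_slice hu hs)).aestronglyMeasurable
  · filter_upwards [self_mem_nhdsWithin] with s hs
    refine Filter.Eventually.of_forall fun x _ => ?_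
    rw [Real.norm_eq_abs, abs_mul]
    exact mul_le_mul_of_nonneg_left (hB x s hs) (abs_nonneg _)
  · exact (hw.abs.mul continuous_const).intervalIntegrable _ _
  · refine Filter.Eventually.of_forall fun x _ => ?_
    have hx : ContinuousOn (fun s => u x s) (Set.Ici 0) :=
      hu.continuousOn.comp (f := fun s : ℝ => (x, s)) (by fun_prop) (fun _ hs => hs)
    exact (hx t ht).const_mul (w x)

end Calculus

/-- Grönwall inequality with linear damping at rate `γ` and constant forcing `K`. -/
lemma le_exp_mul_add_of_deriv_le {J J' : ℝ → ℝ} {γ K : ℝ} (hγ : 0 < γ) (hK : 0 ≤ K)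
    (hc : ContinuousOn J (Set.Ici 0)) (hd : ∀ t, 0 < t → HasDerivAt J (J' t) t)
    (hle : ∀ t, 0 < t → J' t ≤ -γ * J t + K) {t : ℝ} (ht : 0 ≤ t) :
    J t ≤ J 0 * exp (-γ * t) + K / γ := by
  have hderiv : ∀ s, 0 < s → HasDerivAt (fun s => exp (γ * s) * (J s - K / γ))
      (exp (γ * s) * (γ * 1) * (J s - K / γ) + exp (γ * s) * J' s) s := fun s hs =>
    (((hasDerivAt_id s).const_mul γ).exp).mul ((hd s hs).sub_const _)
  have hanti : AntitoneOn (fun s => exp (γ * s) * (J s - K / γ)) (Set.Ici 0) := by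
    refine antitoneOn_of_deriv_nonpos (convex_Ici 0)
      ((by fun_prop : Continuous fun s : ℝ => exp (γ * s)).continuousOn.mul
        (hc.sub continuousOn_const)) ?_ ?_
    · intro s hs
      rw [interior_Ici] at hs
      exact (hderiv s hs).differentiableAt.differentiableWithinAt
    · intro s hs
      rw [interior_Ici] at hs
      rw [(hderiv s hs).deriv]
      have h : γ * (J s - K / γ) + J' s ≤ 0 := by
        have : γ * (K / γ) = K := by field_simp
        linarith [hle s hs]
      nlinarith [mul_nonpos_of_nonneg_of_nonpos (exp_pos (γ * s)).le h]
  have h := hanti (Set.mem_Ici.2 le_rfl) (Set.mem_Ici.2 ht) ht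
  simp only [mul_zero, exp_zero, one_mul] at h
  have hpos := exp_pos (-γ * t)
  have hmul : exp (-γ * t) * exp (γ * t) = 1 := by
    rw [← exp_add]; simp
  have h2 := mul_le_mul_of_nonneg_left h hpos.le
  rw [← mul_assoc, hmul, one_mul] at h2
  have : 0 ≤ exp (-γ * t) * (K / γ) := by positivity
  linarith

lemma integral_exp_affine {c : ℝ} (hc : c ≠ 0) (b p q : ℝ) :
    ∫ x in p..q, exp (c * x + b) = (exp (c * q + b) - exp (c * p + b)) / c := by
  rw [intervalIntegral.integral_comp_mul_add (fun x => exp x) hc b, integral_exp, smul_eq_mul]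
  field_simp

/-- Local energy balance against an exponential weight on an interval. -/
lemma integral_exp_mul_deriv_le {e f : ℝ → ℝ → ℝ} {γ η : ℝ} (hη : 0 < η)
    (he : ContDiffOn ℝ (⊤ : ℕ∞) (fun q : ℝ × ℝ => e q.1 q.2) {q : ℝ × ℝ | 0 ≤ q.2})
    (hf : ContDiffOn ℝ (⊤ : ℕ∞) (fun q : ℝ × ℝ => f q.1 q.2) {q : ℝ × ℝ | 0 ≤ q.2})
    (hle : ∀ x t : ℝ, 0 < t → deriv (fun s => e x s) t
      ≤ deriv (fun y => f y t) x - η * f x t ^ 2 - γ * e x t)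
    (c b : ℝ) {p q : ℝ} (hpq : p ≤ q) {t : ℝ} (ht : 0 < t) :
    ∫ x in p..q, exp (c * x + b) * deriv (fun s => e x s) t
      ≤ exp (c * q + b) * f q t - exp (c * p + b) * f p t
        + c ^ 2 / (4 * η) * (∫ x in p..q, exp (c * x + b))
        - γ * ∫ x in p..q, exp (c * x + b) * e x t := by
  have hw : Continuous fun x : ℝ => exp (c * x + b) := by fun_prop
  have hec := continuous_slice he ht.le
  have hfc := continuous_slice hf ht.le
  have hfx := continuous_deriv_fst_slice hf ht
  have hderiv : ∀ x, HasDerivAt (fun y => exp (c * y + b) * f y t)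
      (exp (c * x + b) * (c * 1) * f x t + exp (c * x + b) * deriv (fun y => f y t) x) x :=
    fun x => ((((hasDerivAt_id x).const_mul c).add_const b).exp).mul
      (hasDerivAt_fst_of_contDiffOn hf x ht).differentiableAt.hasDerivAt
  have hcont : Continuous fun x =>
      exp (c * x + b) * (c * 1) * f x t + exp (c * x + b) * deriv (fun y => f y t) x := by
    fun_prop
  have hsum : Continuous fun x =>
      exp (c * x + b) * (c * 1) * f x t + exp (c * x + b) * deriv (fun y => f y t) x
        + c ^ 2 / (4 * η) * exp (c * x + b) := hcont.add (hw.const_mul _)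
  have hdamp : Continuous fun x => γ * (exp (c * x + b) * e x t) := (hw.mul hec).const_mul _
  rw [← intervalIntegral.integral_eq_sub_of_hasDerivAt (fun x _ => hderiv x)
      (hcont.intervalIntegrable p q),
    ← intervalIntegral.integral_const_mul, ← intervalIntegral.integral_const_mul,
    ← intervalIntegral.integral_add (hcont.intervalIntegrable _ _)
      ((hw.const_mul _).intervalIntegrable _ _),
    ← intervalIntegral.integral_sub
      (hsum.intervalIntegrable _ _) (hdamp.intervalIntegrable _ _)]
  refine intervalIntegral.integral_mono_on hpq
    ((hw.mul (continuous_deriv_snd_slice he ht)).intervalIntegrable _ _)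
    ((hsum.sub hdamp).intervalIntegrable _ _)
    fun x _ => ?_
  have hsq : 0 ≤ η * f x t ^ 2 + c * f x t + c ^ 2 / (4 * η) := by
    have : η * f x t ^ 2 + c * f x t + c ^ 2 / (4 * η) = η * (f x t + c / (2 * η)) ^ 2 := by
      field_simp; ring
    rw [this]; positivity
  have := mul_le_mul_of_nonneg_left
    (show deriv (fun s => e x s) t
      ≤ c * f x t + deriv (fun y => f y t) x + c ^ 2 / (4 * η) - γ * e x t by
        linarith [hle x t ht]) (exp_pos (c * x + b)).le
  linarith

/-- Energy estimate on `[a-1, a+1]` with the weight `exp (-μ (|x - a| - 1)₊)` truncated at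
distance `R` from the interval. -/
lemma local_energy_le_truncated {e f : ℝ → ℝ → ℝ} {γ η E₀ B : ℝ} (hγ : 0 < γ) (hη : 0 < η)
    (hE₀ : 0 ≤ E₀)
    (hes : ContDiffOn ℝ (⊤ : ℕ∞) (fun q : ℝ × ℝ => e q.1 q.2) {q : ℝ × ℝ | 0 ≤ q.2})
    (hfs : ContDiffOn ℝ (⊤ : ℕ∞) (fun q : ℝ × ℝ => f q.1 q.2) {q : ℝ × ℝ | 0 ≤ q.2})
    (heB : ∀ x t : ℝ, 0 ≤ t → |e x t| ≤ B)
    (hetB : ∀ x t : ℝ, 0 ≤ t → |deriv (fun s => e x s) t| ≤ B)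
    (hfB : ∀ x t : ℝ, 0 ≤ t → |f x t| ≤ B)
    (hpos : ∀ x t : ℝ, 0 ≤ t → 0 ≤ e x t)
    (hle : ∀ x t : ℝ, 0 < t → deriv (fun s => e x s) t
      ≤ deriv (fun y => f y t) x - η * f x t ^ 2 - γ * e x t)
    (hinit : ∀ x : ℝ, e x 0 ≤ E₀) {μ : ℝ} (hμ : 0 < μ) {R : ℝ} (hR : 0 ≤ R)
    (a : ℝ) {t : ℝ} (ht : 0 ≤ t) :
    ∫ x in (a - 1)..(a + 1), e x t
      ≤ (2 * E₀ + 2 * E₀ / μ) * exp (-γ * t) + (μ / (2 * η) + 2 * B * exp (-μ * R)) / γ := by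
  have hB0 : 0 ≤ B := (abs_nonneg _).trans (heB 0 0 le_rfl)
  have hw : ∀ c b : ℝ, Continuous fun x : ℝ => exp (c * x + b) := fun c b => by fun_prop
  have hmass : ∀ c b p q s : ℝ, p ≤ q → 0 ≤ s →
      0 ≤ ∫ x in p..q, exp (c * x + b) * e x s := fun c b p q s hpq hs =>
    intervalIntegral.integral_nonneg hpq fun x _ => mul_nonneg (exp_pos _).le (hpos x s hs)
  have hinitial : ∀ c b p q : ℝ, p ≤ q →
      ∫ x in p..q, exp (c * x + b) * e x 0 ≤ E₀ * ∫ x in p..q, exp (c * x + b) := by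
    intro c b p q hpq
    rw [← intervalIntegral.integral_const_mul]
    refine intervalIntegral.integral_mono_on hpq
      (((hw c b).mul (continuous_slice hes le_rfl)).intervalIntegrable _ _)
      (((hw c b).const_mul _).intervalIntegrable _ _) fun x _ => ?_
    rw [mul_comm E₀]
    exact mul_le_mul_of_nonneg_left (hinit x) (exp_pos _).le
  have hexpR : exp (-μ * R) ≤ 1 := exp_le_one_iff.2 (by nlinarith)
  have hexpR0 := exp_pos (-μ * R)
  have hmassL : ∫ x in (a - 1 - R)..(a - 1), exp (μ * x + -(μ * (a - 1))) ≤ 1 / μ := by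
    rw [integral_exp_affine hμ.ne']
    gcongr
    rw [show μ * (a - 1) + -(μ * (a - 1)) = 0 by ring, exp_zero]
    linarith [exp_pos (μ * (a - 1 - R) + -(μ * (a - 1)))]
  have hmassR : ∫ x in (a + 1)..(a + 1 + R), exp (-μ * x + μ * (a + 1)) ≤ 1 / μ := by
    rw [integral_exp_affine (neg_ne_zero.2 hμ.ne'), div_neg, ← neg_div]
    gcongr
    rw [show -μ * (a + 1) + μ * (a + 1) = 0 by ring, exp_zero]
    linarith [exp_pos (-μ * (a + 1 + R) + μ * (a + 1))]
  have hmassM : ∫ x in (a - 1)..(a + 1), exp (0 * x + 0) = 2 := by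
    norm_num
  set J : ℝ → ℝ := fun s =>
    (∫ x in (a - 1 - R)..(a - 1), exp (μ * x + -(μ * (a - 1))) * e x s)
      + (∫ x in (a - 1)..(a + 1), exp (0 * x + 0) * e x s)
      + ∫ x in (a + 1)..(a + 1 + R), exp (-μ * x + μ * (a + 1)) * e x s with hJ
  have hcont : ContinuousOn J (Set.Ici 0) :=
    ((continuousOn_integral_weight_mul hes heB (hw _ _) _ _).add
      (continuousOn_integral_weight_mul hes heB (hw _ _) _ _)).add
      (continuousOn_integral_weight_mul hes heB (hw _ _) _ _)
  have hderiv := fun (s : ℝ) (hs : 0 < s) =>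
    ((hasDerivAt_integral_weight_mul hes hetB (hw μ (-(μ * (a - 1)))) (a - 1 - R) (a - 1) hs).add
      (hasDerivAt_integral_weight_mul hes hetB (hw 0 0) (a - 1) (a + 1) hs)).add
      (hasDerivAt_integral_weight_mul hes hetB (hw (-μ) (μ * (a + 1))) (a + 1) (a + 1 + R) hs)
  have hK : 0 ≤ μ / (2 * η) + 2 * B * exp (-μ * R) := by positivity
  have hmain := le_exp_mul_add_of_deriv_le hγ hK hcont hderiv (fun s hs => by
    have hL := integral_exp_mul_deriv_le hη hes hfs hle μ (-(μ * (a - 1)))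
      (show a - 1 - R ≤ a - 1 by linarith) hs
    have hM := integral_exp_mul_deriv_le hη hes hfs hle 0 0 (show a - 1 ≤ a + 1 by linarith) hs
    have hRt := integral_exp_mul_deriv_le hη hes hfs hle (-μ) (μ * (a + 1))
      (show a + 1 ≤ a + 1 + R by linarith) hs
    rw [show μ * (a - 1) + -(μ * (a - 1)) = 0 by ring,
      show μ * (a - 1 - R) + -(μ * (a - 1)) = -μ * R by ring] at hL
    rw [show -μ * (a + 1) + μ * (a + 1) = 0 by ring,
      show -μ * (a + 1 + R) + μ * (a + 1) = -μ * R by ring] at hRt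
    simp only [zero_mul, add_zero, exp_zero, one_mul, neg_sq, ne_eq, OfNat.ofNat_ne_zero,
      not_false_eq_true, zero_pow, zero_div] at hL hM hRt
    simp only [hJ, zero_mul, add_zero, exp_zero, one_mul]
    have hcoef : μ ^ 2 / (4 * η) * (1 / μ) = μ / (4 * η) := by field_simp
    have hsum : μ / (4 * η) + μ / (4 * η) = μ / (2 * η) := by field_simp; norm_num
    have hcpos : 0 ≤ μ ^ 2 / (4 * η) := by positivity
    have h1 := mul_le_mul_of_nonneg_left hmassL hcpos
    have h2 := mul_le_mul_of_nonneg_left hmassR hcpos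
    have h3 := mul_le_mul_of_nonneg_left (abs_le.1 (hfB (a - 1 - R) s hs.le)).1 hexpR0.le
    have h4 := mul_le_mul_of_nonneg_left (abs_le.1 (hfB (a + 1 + R) s hs.le)).2 hexpR0.le
    linarith) ht
  have hJ0 : J 0 ≤ 2 * E₀ + 2 * E₀ / μ := by
    have h1 := hinitial μ (-(μ * (a - 1))) (a - 1 - R) (a - 1) (by linarith)
    have h2 := hinitial 0 0 (a - 1) (a + 1) (by linarith)
    have h3 := hinitial (-μ) (μ * (a + 1)) (a + 1) (a + 1 + R) (by linarith)
    have h4 := mul_le_mul_of_nonneg_left hmassL hE₀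
    have h5 := mul_le_mul_of_nonneg_left hmassR hE₀
    rw [hmassM] at h2
    have h6 : 2 * E₀ / μ = E₀ * (1 / μ) + E₀ * (1 / μ) := by ring
    simp only [hJ]
    linarith
  have hJt : ∫ x in (a - 1)..(a + 1), e x t ≤ J t := by
    have h1 := hmass μ (-(μ * (a - 1))) (a - 1 - R) (a - 1) t (by linarith) ht
    have h2 := hmass (-μ) (μ * (a + 1)) (a + 1) (a + 1 + R) t (by linarith) ht
    simp only [hJ, zero_mul, add_zero, exp_zero, one_mul]
    linarith
  have := mul_le_mul_of_nonneg_right hJ0 (exp_pos (-γ * t)).le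
  linarith

/-- Optimization of `2s²/μ + μ/(2r²)` over `μ > 0`. -/
lemma le_add_of_forall_pos_le {I A s r : ℝ} (hs : 0 ≤ s) (hr : 0 < r)
    (h : ∀ μ : ℝ, 0 < μ → I ≤ A + 2 * s ^ 2 / μ + μ / (2 * r ^ 2)) :
    I ≤ A + 2 * r⁻¹ * s := by
  refine le_of_forall_pos_le_add fun δ hδ => ?_
  have hσ : 0 < s + δ * r := by positivity
  have h1 := h (2 * (s + δ * r) * r) (by positivity)
  have h2 : 2 * s ^ 2 / (2 * (s + δ * r) * r) ≤ r⁻¹ * s := by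
    rw [div_le_iff₀ (by positivity)]
    have : r⁻¹ * s * (2 * (s + δ * r) * r) = 2 * s ^ 2 + 2 * s * (δ * r) := by
      field_simp
    rw [this]
    have : 0 ≤ 2 * s * (δ * r) := by positivity
    linarith
  have h3 : 2 * (s + δ * r) * r / (2 * r ^ 2) = r⁻¹ * s + δ := by
    field_simp
  linarith

/-- Exponential decay of the local energy in the laminar regime: with
`γ = 8π²(1-ε)(1-κ)` and `η = ε(1-κ)/(C₈κ²)`, for every `t ≥ 0`,
`sup_a ∫_{a-1}^{a+1} ê(·,t) ≤ 2E₀ e^{-γt} + 2(ηγ)^{-1/2} √E₀ e^{-γt/2}`. -/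
theorem laminar_local_energy_decay (κ C₈ E₀ ε γ η : ℝ)
    (hκ0 : 0 < κ) (hκ1 : κ < 1) (hC₈ : 0 < C₈) (hE₀ : 0 ≤ E₀)
    (hε0 : 0 < ε) (hε1 : ε < 1)
    (hγ : γ = 8 * π ^ 2 * (1 - ε) * (1 - κ))
    (hη : η = ε * (1 - κ) / (C₈ * κ ^ 2))
    (eh fh dh gh : ℝ → ℝ → ℝ)
    (hes : ContDiffOn ℝ (⊤ : ℕ∞) (fun q : ℝ × ℝ => eh q.1 q.2) {q : ℝ × ℝ | 0 ≤ q.2})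
    (hfs : ContDiffOn ℝ (⊤ : ℕ∞) (fun q : ℝ × ℝ => fh q.1 q.2) {q : ℝ × ℝ | 0 ≤ q.2})
    (hds : ContDiffOn ℝ (⊤ : ℕ∞) (fun q : ℝ × ℝ => dh q.1 q.2) {q : ℝ × ℝ | 0 ≤ q.2})
    (hgs : ContDiffOn ℝ (⊤ : ℕ∞) (fun q : ℝ × ℝ => gh q.1 q.2) {q : ℝ × ℝ | 0 ≤ q.2})
    (hbdd : ∃ B : ℝ, ∀ x₁ t : ℝ, 0 ≤ t →
      |eh x₁ t| ≤ B ∧ |fh x₁ t| ≤ B ∧ |dh x₁ t| ≤ B ∧ |gh x₁ t| ≤ B ∧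
      |deriv (fun y => eh y t) x₁| ≤ B ∧ |deriv (fun s => eh x₁ s) t| ≤ B ∧
      |deriv (fun y => fh y t) x₁| ≤ B ∧ |deriv (fun s => fh x₁ s) t| ≤ B ∧
      |deriv (fun y => dh y t) x₁| ≤ B ∧ |deriv (fun s => dh x₁ s) t| ≤ B ∧
      |deriv (fun y => gh y t) x₁| ≤ B ∧ |deriv (fun s => gh x₁ s) t| ≤ B)
    (hepos : ∀ x₁ t : ℝ, 0 ≤ t → 0 ≤ eh x₁ t)
    (hdpos : ∀ x₁ t : ℝ, 0 ≤ t → 0 ≤ dh x₁ t)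
    (heq : ∀ x₁ t : ℝ, 0 < t →
      deriv (fun s => eh x₁ s) t
        = deriv (fun y => fh y t) x₁ - dh x₁ t - gh x₁ t)
    (hpoin : ∀ x₁ t : ℝ, 0 ≤ t → eh x₁ t ≤ dh x₁ t / (8 * π ^ 2))
    (hf : ∀ x₁ t : ℝ, 0 ≤ t → fh x₁ t ^ 2 ≤ C₈ * κ ^ 2 * dh x₁ t)
    (hg : ∀ x₁ t : ℝ, 0 ≤ t → |gh x₁ t| ≤ κ * dh x₁ t)
    (hinit : ∀ x₁ : ℝ, eh x₁ 0 ≤ E₀) :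
    ∀ t : ℝ, 0 ≤ t → ∀ a : ℝ,
      (∫ x₁ in (a - 1)..(a + 1), eh x₁ t)
        ≤ 2 * E₀ * Real.exp (-γ * t)
          + 2 * (Real.sqrt (η * γ))⁻¹ * Real.sqrt E₀ * Real.exp (-γ * t / 2) := by
  intro t ht a
  obtain ⟨B, hB⟩ := hbdd
  have hκ' : 0 < 1 - κ := by linarith
  have hε' : 0 < 1 - ε := by linarith
  have hγ0 : 0 < γ := by rw [hγ]; positivity
  have hη0 : 0 < η := by rw [hη]; positivity
  have hle : ∀ x t : ℝ, 0 < t → deriv (fun s => eh x s) t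
      ≤ deriv (fun y => fh y t) x - η * fh x t ^ 2 - γ * eh x t := by
    intro x t ht
    have h1 : η * fh x t ^ 2 ≤ ε * (1 - κ) * dh x t := by
      have hηC : η * (C₈ * κ ^ 2) = ε * (1 - κ) := by rw [hη]; field_simp
      rw [← hηC, mul_assoc]
      exact mul_le_mul_of_nonneg_left (hf x t ht.le) hη0.le
    have h2 : γ * eh x t ≤ (1 - ε) * (1 - κ) * dh x t := by
      have h := (le_div_iff₀ (by positivity)).1 (hpoin x t ht.le)
      have := mul_le_mul_of_nonneg_left h (mul_nonneg hε'.le hκ'.le)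
      rw [hγ]
      linarith
    have h3 := (abs_le.1 (hg x t ht.le)).1
    rw [heq x t ht]
    linarith
  have htrunc : ∀ μ : ℝ, 0 < μ → ∫ x in (a - 1)..(a + 1), eh x t
      ≤ (2 * E₀ + 2 * E₀ / μ) * exp (-γ * t) + μ / (2 * η) / γ := by
    intro μ hμ
    have hdecay : Filter.Tendsto (fun R : ℝ => exp (-μ * R)) Filter.atTop (nhds 0) :=
      tendsto_exp_atBot.comp (Filter.tendsto_id.const_mul_atTop_of_neg (neg_lt_zero.2 hμ))
    have hlim := (((hdecay.const_mul (2 * B)).const_add (μ / (2 * η))).div_const γ).const_add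
      ((2 * E₀ + 2 * E₀ / μ) * exp (-γ * t))
    rw [mul_zero, add_zero] at hlim
    refine ge_of_tendsto hlim ?_
    filter_upwards [Filter.eventually_ge_atTop 0] with R hR
    exact local_energy_le_truncated hγ0 hη0 hE₀ hes hfs
      (fun x t ht => (hB x t ht).1) (fun x t ht => (hB x t ht).2.2.2.2.2.1)
      (fun x t ht => (hB x t ht).2.1) hepos hle hinit hμ hR a ht
  have hsq : (√E₀ * exp (-γ * t / 2)) ^ 2 = E₀ * exp (-γ * t) := by
    rw [mul_pow, sq_sqrt hE₀, ← exp_nat_mul]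
    congr 2
    push_cast
    ring
  have hopt := le_add_of_forall_pos_le (A := 2 * E₀ * exp (-γ * t))
    (s := √E₀ * exp (-γ * t / 2)) (r := √(η * γ)) (by positivity) (by positivity)
    (I := ∫ x in (a - 1)..(a + 1), eh x t) (fun μ hμ => by
      refine (htrunc μ hμ).trans_eq ?_
      rw [hsq, sq_sqrt (by positivity), div_div]
      ring)
  linarith

end NS
end
end

section
/- Let A > 0, B > 0 and let F : ℝ → ℝ be differentiable with F'(x) ≥ −A + B·F(x)² for all x ∈ ℝ. Then F(x)² ≤ A/B for all x ∈ ℝ. -/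
noncomputable section

namespace NS

/-- A differentiable function satisfying `F' ≥ -A + B F²` stays above any level `a` with
`A < B a²` once it has reached it. -/
lemma riccati_level_le {A B a x₀ : ℝ} (ha : A < B * a ^ 2)
    {F : ℝ → ℝ} (hF : Differentiable ℝ F)
    (h : ∀ x : ℝ, -A + B * F x ^ 2 ≤ deriv F x) (hx₀ : a ≤ F x₀)
    {x : ℝ} (hx : x₀ ≤ x) : a ≤ F x := by
  refine image_le_of_deriv_right_lt_deriv_boundary' (f := fun _ => a) (f' := fun _ => 0)
    (B := F) (B' := deriv F) (a := x₀) (b := x) continuousOn_const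
    (fun y _ => hasDerivWithinAt_const _ _ _) hx₀ hF.continuous.continuousOn
    (fun y _ => (hF y).hasDerivAt.hasDerivWithinAt) ?_ (Set.right_mem_Icc.2 hx)
  intro y _ hy
  have := h y
  rw [← hy] at this
  linarith

/-- A global solution of `F' ≥ -A + B F²` takes no positive value `F x₀` with
`A < B (F x₀)²`, since it would blow up in finite time to the right of `x₀`. -/
lemma riccati_sq_le_of_pos {A B : ℝ} (hA : 0 < A)
    {F : ℝ → ℝ} (hF : Differentiable ℝ F)
    (h : ∀ x : ℝ, -A + B * F x ^ 2 ≤ deriv F x) {x₀ : ℝ} (hpos : 0 < F x₀) :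
    B * F x₀ ^ 2 ≤ A := by
  by_contra! hlt
  have hle : ∀ x, x₀ ≤ x → F x₀ ≤ F x := fun x hx => riccati_level_le hlt hF h le_rfl hx
  set a := F x₀ with ha
  set k := B - A / a ^ 2 with hk
  have hkpos : 0 < k := by
    rw [hk, sub_pos, div_lt_iff₀ (by positivity)]
    exact hlt
  have hderiv : ∀ x, x₀ ≤ x →
      HasDerivAt (fun y => -(F y)⁻¹) (deriv F x / F x ^ 2) x := fun x hx => by
    have hne : F x ≠ 0 := (hpos.trans_le (hle x hx)).ne'
    simpa [neg_div] using ((hF x).hasDerivAt.fun_inv hne).fun_neg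
  have hgrow := (convex_Ici x₀).mul_sub_le_image_sub_of_le_deriv (C := k)
    (f := fun y => -(F y)⁻¹)
    (fun x hx => (hderiv x hx).continuousAt.continuousWithinAt)
    (fun x hx => (hderiv x (interior_subset hx)).differentiableAt.differentiableWithinAt)
    (fun x hx => by
      have hx' : x₀ ≤ x := interior_subset hx
      have hax := hle x hx'
      have hFx : 0 < F x := hpos.trans_le hax
      rw [(hderiv x hx').deriv, le_div_iff₀ (by positivity)]
      have hone : A ≤ A / a ^ 2 * F x ^ 2 := by
        rw [div_mul_eq_mul_div, le_div_iff₀ (by positivity)]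
        gcongr
      have := h x
      rw [hk]
      linarith)
  have hx₁ : x₀ ≤ x₀ + a⁻¹ / k := le_add_of_nonneg_right (by positivity)
  have hblow := hgrow x₀ Set.self_mem_Ici (x₀ + a⁻¹ / k) hx₁ hx₁
  have hinv : 0 < (F (x₀ + a⁻¹ / k))⁻¹ := inv_pos.2 (hpos.trans_le (hle _ hx₁))
  rw [add_sub_cancel_left, mul_div_cancel₀ _ hkpos.ne'] at hblow
  simp only [← ha] at hblow
  linarith

/-- A globally defined differentiable function satisfying the Riccati-type
inequality `F' ≥ -A + B F²` must satisfy `F² ≤ A/B` everywhere. -/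
theorem riccati_global_bound (A B : ℝ) (hA : 0 < A) (hB : 0 < B)
    (F : ℝ → ℝ) (hF : Differentiable ℝ F)
    (h : ∀ x : ℝ, -A + B * F x ^ 2 ≤ deriv F x) :
    ∀ x : ℝ, F x ^ 2 ≤ A / B := by
  intro x
  rw [le_div_iff₀ hB, mul_comm]
  rcases lt_trichotomy (F x) 0 with hneg | hzero | hpos
  · have hderiv : ∀ y, deriv (fun z => -F (-z)) y = deriv F (-y) := fun y => by
      rw [deriv.fun_neg, deriv_comp_neg, neg_neg]
    simpa using riccati_sq_le_of_pos (B := B) (F := fun z => -F (-z)) (x₀ := -x) hA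
      (hF.comp differentiable_neg).neg
      (fun y => by simpa [hderiv] using h (-y)) (by simpa using hneg)
  · simp [hzero, hA.le]
  · exact riccati_sq_le_of_pos hA hF h hpos

end NS
end
end

section
/- Let u : ℝ² → ℝ² be a twice continuously differentiable divergence-free vector field (∂₁u₁ + ∂₂u₂ = 0) and let ω = ∂₁u₂ − ∂₂u₁. Then div((u·∇)u) = Δ(u₁²) + 2∂₂(ω u₁), i.e. ∂₁(u₁∂₁u₁ + u₂∂₂u₁) + ∂₂(u₁∂₁u₂ + u₂∂₂u₂) = (∂₁² + ∂₂²)(u₁²) + 2∂₂(ω u₁). -/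
noncomputable section

namespace NS

theorem pd1_eq_fderiv {g : ℝ × ℝ → ℝ} {x : ℝ × ℝ} (hg : DifferentiableAt ℝ g x) :
    pd1 g x = fderiv ℝ g x (1, 0) :=
  (HasFDerivAt.comp_hasDerivAt (f := fun y : ℝ => (y, x.2)) x.1 hg.hasFDerivAt
    ((hasDerivAt_id x.1).prodMk (hasDerivAt_const x.1 x.2))).deriv

theorem pd2_eq_fderiv {g : ℝ × ℝ → ℝ} {x : ℝ × ℝ} (hg : DifferentiableAt ℝ g x) :
    pd2 g x = fderiv ℝ g x (0, 1) :=
  (HasFDerivAt.comp_hasDerivAt (f := fun y : ℝ => (x.1, y)) x.2 hg.hasFDerivAt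
    ((hasDerivAt_const x.2 x.1).prodMk (hasDerivAt_id x.2))).deriv

theorem differentiable_pd1 {g : ℝ × ℝ → ℝ} (hg : ContDiff ℝ 2 g) : Differentiable ℝ (pd1 g) := by
  rw [show pd1 g = _ from funext fun x => pd1_eq_fderiv (hg.differentiable (by norm_num) x)]
  exact ((hg.fderiv_right (m := 1) (by norm_num)).differentiable (by norm_num)).clm_apply
    (differentiable_const _)

theorem differentiable_pd2 {g : ℝ × ℝ → ℝ} (hg : ContDiff ℝ 2 g) : Differentiable ℝ (pd2 g) := by
  rw [show pd2 g = _ from funext fun x => pd2_eq_fderiv (hg.differentiable (by norm_num) x)]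
  exact ((hg.fderiv_right (m := 1) (by norm_num)).differentiable (by norm_num)).clm_apply
    (differentiable_const _)

/-- Mixed partial derivatives of a `C²` function commute. -/
theorem pd1_pd2_comm {g : ℝ × ℝ → ℝ} (hg : ContDiff ℝ 2 g) (x : ℝ × ℝ) :
    pd1 (pd2 g) x = pd2 (pd1 g) x := by
  have hd : DifferentiableAt ℝ (fderiv ℝ g) x :=
    (hg.fderiv_right (m := 1) (by norm_num)).differentiable (by norm_num) x
  have hsymm : IsSymmSndFDerivAt ℝ g x := hg.contDiffAt.isSymmSndFDerivAt (by simp)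
  rw [pd1_eq_fderiv (differentiable_pd2 hg x), pd2_eq_fderiv (differentiable_pd1 hg x),
    show pd1 g = _ from funext fun x => pd1_eq_fderiv (hg.differentiable (by norm_num) x),
    show pd2 g = _ from funext fun x => pd2_eq_fderiv (hg.differentiable (by norm_num) x),
    fderiv_clm_apply hd (differentiableAt_const _), fderiv_clm_apply hd (differentiableAt_const _)]
  simpa using hsymm (1, 0) (0, 1)

theorem pd1_add {f g : ℝ × ℝ → ℝ} {x : ℝ × ℝ} (hf : DifferentiableAt ℝ f x)
    (hg : DifferentiableAt ℝ g x) :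
    pd1 (fun y => f y + g y) x = pd1 f x + pd1 g x := by
  rw [pd1_eq_fderiv (hf.fun_add hg), pd1_eq_fderiv hf, pd1_eq_fderiv hg, fderiv_fun_add hf hg]
  simp

theorem pd1_mul {f g : ℝ × ℝ → ℝ} {x : ℝ × ℝ} (hf : DifferentiableAt ℝ f x)
    (hg : DifferentiableAt ℝ g x) :
    pd1 (fun y => f y * g y) x = f x * pd1 g x + g x * pd1 f x := by
  rw [pd1_eq_fderiv (hf.fun_mul hg), pd1_eq_fderiv hf, pd1_eq_fderiv hg, fderiv_fun_mul hf hg]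
  simp

theorem pd2_add {f g : ℝ × ℝ → ℝ} {x : ℝ × ℝ} (hf : DifferentiableAt ℝ f x)
    (hg : DifferentiableAt ℝ g x) :
    pd2 (fun y => f y + g y) x = pd2 f x + pd2 g x := by
  rw [pd2_eq_fderiv (hf.fun_add hg), pd2_eq_fderiv hf, pd2_eq_fderiv hg, fderiv_fun_add hf hg]
  simp

theorem pd2_sub {f g : ℝ × ℝ → ℝ} {x : ℝ × ℝ} (hf : DifferentiableAt ℝ f x)
    (hg : DifferentiableAt ℝ g x) :
    pd2 (fun y => f y - g y) x = pd2 f x - pd2 g x := by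
  rw [pd2_eq_fderiv (hf.fun_sub hg), pd2_eq_fderiv hf, pd2_eq_fderiv hg, fderiv_fun_sub hf hg]
  simp

theorem pd2_mul {f g : ℝ × ℝ → ℝ} {x : ℝ × ℝ} (hf : DifferentiableAt ℝ f x)
    (hg : DifferentiableAt ℝ g x) :
    pd2 (fun y => f y * g y) x = f x * pd2 g x + g x * pd2 f x := by
  rw [pd2_eq_fderiv (hf.fun_mul hg), pd2_eq_fderiv hf, pd2_eq_fderiv hg, fderiv_fun_mul hf hg]
  simp

/-- For a `C²` divergence-free vector field `u` on `ℝ²` with vorticity `ω`,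
`div((u·∇)u) = Δ(u₁²) + 2∂₂(ω u₁)`. -/
theorem div_advection_identity (u : ℝ × ℝ → ℝ × ℝ) (hu : ContDiff ℝ 2 u)
    (hdiv : ∀ x : ℝ × ℝ,
      pd1 (fun y => (u y).1) x + pd2 (fun y => (u y).2) x = 0)
    (x : ℝ × ℝ) :
    pd1 (fun y => (u y).1 * pd1 (fun z => (u z).1) y
        + (u y).2 * pd2 (fun z => (u z).1) y) x
      + pd2 (fun y => (u y).1 * pd1 (fun z => (u z).2) y
        + (u y).2 * pd2 (fun z => (u z).2) y) x
    = pd1 (pd1 (fun y => (u y).1 ^ 2)) x + pd2 (pd2 (fun y => (u y).1 ^ 2)) x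
      + 2 * pd2 (fun y => vort u y * (u y).1) x := by
  set a : ℝ × ℝ → ℝ := fun y => (u y).1
  set b : ℝ × ℝ → ℝ := fun y => (u y).2
  have ca : ContDiff ℝ 2 a := hu.fst
  have cb : ContDiff ℝ 2 b := hu.snd
  have da : Differentiable ℝ a := ca.differentiable (by norm_num)
  have db : Differentiable ℝ b := cb.differentiable (by norm_num)
  have da1 := differentiable_pd1 ca
  have da2 := differentiable_pd2 ca
  have db1 := differentiable_pd1 cb
  have db2 := differentiable_pd2 cb
  have sq1 : pd1 (fun y => a y ^ 2) = fun y => a y * pd1 a y + a y * pd1 a y := by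
    funext y
    simp only [pow_two]
    exact pd1_mul (da y) (da y)
  have sq2 : pd2 (fun y => a y ^ 2) = fun y => a y * pd2 a y + a y * pd2 a y := by
    funext y
    simp only [pow_two]
    exact pd2_mul (da y) (da y)
  have hz : (fun y => pd1 a y + pd2 b y) = fun _ => 0 := funext hdiv
  have hz1 : pd1 (pd1 a) x + pd1 (pd2 b) x = 0 := by
    rw [← pd1_add (da1 x) (db2 x), hz]
    simp [pd1]
  have hz2 : pd2 (pd1 a) x + pd2 (pd2 b) x = 0 := by
    rw [← pd2_add (da1 x) (db2 x), hz]
    simp [pd2]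
  have hca := pd1_pd2_comm ca x
  have hcb := pd1_pd2_comm cb x
  have h0 := hdiv x
  change pd1 (fun y => a y * pd1 a y + b y * pd2 a y) x
      + pd2 (fun y => a y * pd1 b y + b y * pd2 b y) x
    = pd1 (pd1 (fun y => a y ^ 2)) x + pd2 (pd2 (fun y => a y ^ 2)) x
      + 2 * pd2 (fun y => (pd1 b y - pd2 a y) * a y) x
  rw [sq1, sq2,
    pd1_add ((da x).fun_mul (da1 x)) ((db x).fun_mul (da2 x)),
    pd2_add ((da x).fun_mul (db1 x)) ((db x).fun_mul (db2 x)),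
    pd1_add ((da x).fun_mul (da1 x)) ((da x).fun_mul (da1 x)),
    pd2_add ((da x).fun_mul (da2 x)) ((da x).fun_mul (da2 x)),
    pd2_mul ((db1 x).fun_sub (da2 x)) (da x), pd2_sub (db1 x) (da2 x),
    pd1_mul (da x) (da1 x), pd1_mul (db x) (da2 x), pd2_mul (da x) (db1 x),
    pd2_mul (db x) (db2 x), pd2_mul (da x) (da2 x)]
  linear_combination b x * hz2 + b x * hca - a x * hz1 + a x * hcb
    + (pd2 b x - pd1 a x) * h0

end NS
end
end

section
/- For every R > 0, the measure of the ball of radius R in the dual of ℝ × 𝕋 satisfies μ(Ω̂_R) ≤ max(R, R²); explicitly, (1/(2π)) ∫_ℝ ( ∑_{n∈ℤ} 1_{ k² + 4π²n² ≤ R² } ) dk ≤ max(R, R²). -/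
noncomputable section

open Real

namespace NS

/-- The slice at height `k` of the dual ball of radius `R` has at most `R / π + 1` points, and is
empty unless `|k| ≤ R`. -/
lemma tsum_slice_le (R : ℝ) (hR : 0 < R) (k : ℝ) :
    (∑' n : ℤ, if k ^ 2 + 4 * π ^ 2 * (n : ℝ) ^ 2 ≤ R ^ 2 then (1:ℝ) else 0)
      ≤ (Set.Icc (-R) R).indicator (fun _ => R / π + 1) k := by
  by_cases hk : k ∈ Set.Icc (-R) R
  · rw [Set.indicator_of_mem hk]
    have hN : 0 ≤ ⌊R / (2 * π)⌋ := Int.floor_nonneg.2 (by positivity)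
    have hNle : (⌊R / (2 * π)⌋ : ℝ) ≤ R / (2 * π) := Int.floor_le _
    rw [tsum_eq_sum (s := Finset.Icc (-⌊R / (2 * π)⌋) ⌊R / (2 * π)⌋)]
    · calc _ ≤ ∑ n ∈ Finset.Icc (-⌊R / (2 * π)⌋) ⌊R / (2 * π)⌋, (1 : ℝ) :=
            Finset.sum_le_sum fun n _ => by split_ifs <;> norm_num
        _ = 2 * (⌊R / (2 * π)⌋ : ℝ) + 1 := by
            rw [Finset.sum_const, Int.card_Icc, nsmul_eq_mul, mul_one, ← Int.cast_natCast,
              Int.toNat_of_nonneg (by omega)]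
            push_cast
            ring
        _ ≤ 2 * (R / (2 * π)) + 1 := by gcongr
        _ = R / π + 1 := by field_simp
    · intro n hn
      refine if_neg fun h => hn ?_
      have hsq : (2 * π * (n : ℝ)) ^ 2 ≤ R ^ 2 := by nlinarith [sq_nonneg k]
      obtain ⟨h1, h2⟩ := abs_le.1 (abs_le_of_sq_le_sq hsq hR.le)
      have hpos : 0 < 2 * π := by positivity
      rw [Finset.mem_Icc, neg_le]
      constructor <;> rw [Int.le_floor, le_div_iff₀ hpos] <;> push_cast <;> linarith
  · rw [Set.indicator_of_notMem hk]
    refine (tsum_congr fun n => if_neg fun h => hk ?_).trans tsum_zero |>.le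
    have hsq : k ^ 2 ≤ R ^ 2 := le_trans (le_add_of_nonneg_right (by positivity)) h
    exact abs_le.1 (abs_le_of_sq_le_sq hsq hR.le)

/-- The measure of the ball of radius `R` in the dual `Ω̂ = ℝ × 2πℤ` of the cylinder
`ℝ × 𝕋` is at most `max (R, R²)`. -/
theorem dual_ball_measure (R : ℝ) (hR : 0 < R) :
    (1 / (2 * π)) * (∫ k : ℝ,
        ∑' n : ℤ, if k ^ 2 + 4 * π ^ 2 * (n : ℝ) ^ 2 ≤ R ^ 2 then (1:ℝ) else 0)
      ≤ max R (R ^ 2) := by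
  have hint : (∫ k : ℝ,
      ∑' n : ℤ, if k ^ 2 + 4 * π ^ 2 * (n : ℝ) ^ 2 ≤ R ^ 2 then (1:ℝ) else 0)
        ≤ 2 * R * (R / π + 1) := by
    calc _ ≤ ∫ k : ℝ, (Set.Icc (-R) R).indicator (fun _ => R / π + 1) k := by
          refine MeasureTheory.integral_mono_of_nonneg
            (.of_forall fun k => tsum_nonneg fun n => by split_ifs <;> norm_num) ?_
            (.of_forall (tsum_slice_le R hR))
          exact (MeasureTheory.integrable_indicator_iff measurableSet_Icc).2
            (MeasureTheory.integrableOn_const (by simp))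
      _ = 2 * R * (R / π + 1) := by
          rw [MeasureTheory.integral_indicator measurableSet_Icc, MeasureTheory.setIntegral_const,
            Real.volume_real_Icc_of_le (by linarith), smul_eq_mul]
          ring
  have hinv : π⁻¹ ≤ 1 / 3 := by
    rw [one_div]
    exact inv_anti₀ (by norm_num) pi_gt_three.le
  have hinv0 : 0 < π⁻¹ := by positivity
  calc _ ≤ 1 / (2 * π) * (2 * R * (R / π + 1)) := by gcongr
    _ = π⁻¹ ^ 2 * R ^ 2 + π⁻¹ * R := by field_simp
    _ ≤ (1 / 3) ^ 2 * max R (R ^ 2) + 1 / 3 * max R (R ^ 2) := by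
        gcongr
        exacts [le_max_right _ _, le_max_left _ _]
    _ ≤ max R (R ^ 2) := by linarith [le_max_left R (R ^ 2)]

end NS
end
end
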